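/- arXiv:2411.03674 — 3 statements merged into one kernel-verified Lean document; each statement's English description precedes it below -/
import Mathlib

section
/- Let n ≥ 5 be an integer. Let ℱ ⊆ ([n] choose 2) and 𝒢 ⊆ ([n] choose 2) be cross-intersecting families with |ℱ ∩ 𝒢| ≤ 1, |ℱ| ≥ 2 and |𝒢| ≥ 2. Then |ℱ| + |𝒢| ≤ C(n,2) − C(n−2,2) − C(n−3,1) + 1. -/
open Finset

/-- Two unordered pairs that meet share an endpoint. -/
lemma pair_inter_nonempty {a b c d : ℕ} (h : (({a, b} : Finset ℕ) ∩ {c, d}).Nonempty) :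
    a = c ∨ a = d ∨ b = c ∨ b = d := by
  obtain ⟨x, hx⟩ := h
  simp only [mem_inter, mem_insert, mem_singleton] at hx
  grind

/-- If every member of `F ∪ G` other than `S` contains the vertex `a`, then `|F| + |G|` is at
most `n + 1`. -/
lemma card_add_card_le_of_star {n a : ℕ} {F G : Finset (Finset ℕ)} {S : Finset ℕ}
    (hF : F ⊆ powersetCard 2 (Icc 1 n)) (hG : G ⊆ powersetCard 2 (Icc 1 n))
    (hmeet : (F ∩ G).card ≤ 1) (ha : a ∈ Icc 1 n)
    (hstar : ∀ X ∈ F ∪ G, a ∈ X ∨ X = S) : F.card + G.card ≤ n + 1 := by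
  have hsub : F ∪ G ⊆ insert S (((Icc 1 n).erase a).image fun v => ({a, v} : Finset ℕ)) := by
    intro X hX
    rcases hstar X hX with h | h
    · have hX' := mem_powersetCard.1 (union_subset hF hG hX)
      obtain ⟨x, y, hxy, rfl⟩ := card_eq_two.1 hX'.2
      have hx : x ∈ Icc 1 n := hX'.1 (by simp)
      have hy : y ∈ Icc 1 n := hX'.1 (by simp)
      refine mem_insert_of_mem (mem_image.2 ?_)
      simp only [mem_insert, mem_singleton] at h
      rcases h with rfl | rfl
      · exact ⟨y, mem_erase.2 ⟨hxy.symm, hy⟩, rfl⟩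
      · exact ⟨x, mem_erase.2 ⟨hxy, hx⟩, pair_comm _ _⟩
    · exact h ▸ mem_insert_self _ _
  have h1 := card_le_card hsub
  have h2 := card_insert_le S (((Icc 1 n).erase a).image fun v => ({a, v} : Finset ℕ))
  have h3 : (((Icc 1 n).erase a).image fun v => ({a, v} : Finset ℕ)).card ≤ n - 1 := by
    refine card_image_le.trans ?_
    rw [card_erase_of_mem ha, Nat.card_Icc]
    omega
  have h4 := card_union_add_card_inter F G
  have h5 := mem_Icc.1 ha
  omega

/-- A pair meeting both `{a, b}` and `{c, d}`, where these are disjoint, is one of four pairs. -/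
lemma card_le_four_of_disjoint_pairs {n a b c d : ℕ} {F G : Finset (Finset ℕ)}
    (hF : F ⊆ powersetCard 2 (Icc 1 n))
    (hcross : ∀ A ∈ F, ∀ B ∈ G, (A ∩ B).Nonempty)
    (h1 : {a, b} ∈ G) (h2 : {c, d} ∈ G)
    (hac : a ≠ c) (had : a ≠ d) (hbc : b ≠ c) (hbd : b ≠ d) : F.card ≤ 4 := by
  refine (card_le_card (t := {{a, c}, {a, d}, {b, c}, {b, d}}) fun X hX => ?_).trans
    card_le_four
  obtain ⟨x, y, hxy, rfl⟩ := card_eq_two.1 (mem_powersetCard.1 (hF hX)).2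
  have i1 := pair_inter_nonempty (hcross _ hX _ h1)
  have i2 := pair_inter_nonempty (hcross _ hX _ h2)
  simp only [mem_insert, mem_singleton]
  grind [pair_comm]

/-- A pair meeting both `{a, b}` and `{a, c}` contains `a` or equals `{b, c}`. -/
lemma mem_or_eq_of_adjacent_pairs {n a b c : ℕ} {F G : Finset (Finset ℕ)}
    (hF : F ⊆ powersetCard 2 (Icc 1 n))
    (hcross : ∀ A ∈ F, ∀ B ∈ G, (A ∩ B).Nonempty)
    (h1 : {a, b} ∈ G) (h2 : {a, c} ∈ G) (hbc : b ≠ c) :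
    ∀ X ∈ F, a ∈ X ∨ X = {b, c} := by
  intro X hX
  obtain ⟨x, y, hxy, rfl⟩ := card_eq_two.1 (mem_powersetCard.1 (hF hX)).2
  have i1 := pair_inter_nonempty (hcross _ hX _ h1)
  have i2 := pair_inter_nonempty (hcross _ hX _ h2)
  simp only [mem_insert, mem_singleton]
  grind [pair_comm]

/-- The case where one family contains the path `c - a - b - e`. -/
lemma card_add_card_le_of_path {n a b c e : ℕ} (hn : 5 ≤ n) {F G : Finset (Finset ℕ)}
    (hF : F ⊆ powersetCard 2 (Icc 1 n)) (hG : G ⊆ powersetCard 2 (Icc 1 n))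
    (hcross : ∀ A ∈ F, ∀ B ∈ G, (A ∩ B).Nonempty)
    (hmeet : (F ∩ G).card ≤ 1) (hF2 : 2 ≤ F.card)
    (hab : {a, b} ∈ G) (hac : {a, c} ∈ G) (hbe : {b, e} ∈ G)
    (nab : a ≠ b) (nac : a ≠ c) (nbc : b ≠ c) (nae : a ≠ e) (nbe : b ≠ e) (nce : c ≠ e) :
    F.card + G.card ≤ n + 1 := by
  have hcross' : ∀ A ∈ G, ∀ B ∈ F, (A ∩ B).Nonempty := fun A hA B hB => by
    rw [inter_comm]; exact hcross B hB A hA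
  have hb : b ∈ Icc 1 n := (mem_powersetCard.1 (hG hab)).1 (by simp)
  have ha : a ∈ Icc 1 n := (mem_powersetCard.1 (hG hab)).1 (by simp)
  have hsub : ∀ X ∈ F, X = {a, b} ∨ X = {a, e} ∨ X = {b, c} := by
    intro X hX
    obtain ⟨x, y, hxy, rfl⟩ := card_eq_two.1 (mem_powersetCard.1 (hF hX)).2
    have i1 := pair_inter_nonempty (hcross _ hX _ hab)
    have i2 := pair_inter_nonempty (hcross _ hX _ hac)
    have i3 := pair_inter_nonempty (hcross _ hX _ hbe)
    grind [pair_comm]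
  by_cases q1 : {a, e} ∈ F
  · by_cases q2 : {b, c} ∈ F
    · by_cases q3 : {a, b} ∈ F
      · have hF3 : F.card ≤ 3 :=
          (card_le_card (t := {{a, b}, {a, e}, {b, c}}) fun X hX => by
            simpa using hsub X hX).trans card_le_three
        have hG3 : G.card ≤ 3 := by
          refine (card_le_card (t := {{a, b}, {a, c}, {b, e}}) fun X hX => ?_).trans
            card_le_three
          obtain ⟨x, y, hxy, rfl⟩ := card_eq_two.1 (mem_powersetCard.1 (hG hX)).2
          have i1 := pair_inter_nonempty (hcross' _ hX _ q1)
          have i2 := pair_inter_nonempty (hcross' _ hX _ q2)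
          have i3 := pair_inter_nonempty (hcross' _ hX _ q3)
          simp only [mem_insert, mem_singleton]
          grind [pair_comm]
        omega
      · have hF' : F.card ≤ 2 :=
          (card_le_card (t := {{a, e}, {b, c}}) fun X hX => by
            have := hsub X hX
            simp only [mem_insert, mem_singleton]
            grind).trans card_le_two
        have := card_le_four_of_disjoint_pairs hG hcross' q1 q2 nab nac nbe.symm nce.symm
        omega
    · have q3 : {a, b} ∈ F := by
        by_contra q3
        have : F.card ≤ 1 := card_le_one.2 fun X hX Y hY => by
          have := hsub X hX
          have := hsub Y hY
          grind
        omega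
      have := mem_or_eq_of_adjacent_pairs hG hcross' q3 q1 nbe
      refine card_add_card_le_of_star (S := {b, e}) hF hG hmeet ha fun X hX => ?_
      rcases mem_union.1 hX with h | h
      · rcases hsub X h with rfl | rfl | rfl
        · simp
        · simp
        · exact absurd h q2
      · exact this X h
  · have hsub' : ∀ X ∈ F, X = {a, b} ∨ X = {b, c} := fun X hX => by
      have := hsub X hX
      grind
    have q3 : {b, a} ∈ F ∧ {b, c} ∈ F := by
      rw [pair_comm b a]
      by_contra q3
      have : F.card ≤ 1 := card_le_one.2 fun X hX Y hY => by
        have := hsub' X hX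
        have := hsub' Y hY
        grind
      omega
    have := mem_or_eq_of_adjacent_pairs hG hcross' q3.1 q3.2 nac
    refine card_add_card_le_of_star (S := {a, c}) hF hG hmeet hb fun X hX => ?_
    rcases mem_union.1 hX with h | h
    · rcases hsub' X h with rfl | rfl <;> simp
    · exact this X h

/-- The case where one family contains two adjacent pairs. -/
lemma card_add_card_le_of_adjacent {n a b c : ℕ} (hn : 5 ≤ n) {F G : Finset (Finset ℕ)}
    (hF : F ⊆ powersetCard 2 (Icc 1 n)) (hG : G ⊆ powersetCard 2 (Icc 1 n))
    (hcross : ∀ A ∈ F, ∀ B ∈ G, (A ∩ B).Nonempty)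
    (hmeet : (F ∩ G).card ≤ 1) (hF2 : 2 ≤ F.card)
    (hab : {a, b} ∈ G) (hac : {a, c} ∈ G)
    (nab : a ≠ b) (nac : a ≠ c) (nbc : b ≠ c) : F.card + G.card ≤ n + 1 := by
  have hcross' : ∀ A ∈ G, ∀ B ∈ F, (A ∩ B).Nonempty := fun A hA B hB => by
    rw [inter_comm]; exact hcross B hB A hA
  have ha : a ∈ Icc 1 n := (mem_powersetCard.1 (hG hab)).1 (by simp)
  have hFs := mem_or_eq_of_adjacent_pairs hF hcross hab hac nbc
  by_cases hD : ∀ X ∈ G, a ∈ X ∨ X = {b, c}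
  · exact card_add_card_le_of_star hF hG hmeet ha fun X hX =>
      (mem_union.1 hX).elim (hFs X) (hD X)
  push Not at hD
  obtain ⟨D, hDG, haD, hDbc⟩ := hD
  obtain ⟨d, e, hde, rfl⟩ := card_eq_two.1 (mem_powersetCard.1 (hG hDG)).2
  simp only [mem_insert, mem_singleton, not_or] at haD
  by_cases hbcF : {b, c} ∈ F
  · rcases pair_inter_nonempty (hcross _ hbcF _ hDG) with rfl | rfl | rfl | rfl
    · exact card_add_card_le_of_path hn hF hG hcross hmeet hF2 hab hac hDG nab nac nbc
        haD.2 hde (by rintro rfl; exact hDbc rfl)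
    · rw [pair_comm] at hDG hDbc
      exact card_add_card_le_of_path hn hF hG hcross hmeet hF2 hab hac hDG nab nac nbc
        haD.1 hde.symm (by rintro rfl; exact hDbc rfl)
    · exact card_add_card_le_of_path hn hF hG hcross hmeet hF2 hac hab hDG nac nab nbc.symm
        haD.2 hde (by rintro rfl; exact hDbc (pair_comm _ _))
    · rw [pair_comm] at hDG
      exact card_add_card_le_of_path hn hF hG hcross hmeet hF2 hac hab hDG nac nab nbc.symm
        haD.1 hde.symm (by rintro rfl; exact hDbc rfl)
  · have hsub : ∀ X ∈ F, X = {a, d} ∨ X = {a, e} := by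
      intro X hX
      have h := hFs X hX
      obtain ⟨x, y, hxy, rfl⟩ := card_eq_two.1 (mem_powersetCard.1 (hF hX)).2
      have i := pair_inter_nonempty (hcross _ hX _ hDG)
      simp only [mem_insert, mem_singleton] at h
      grind [pair_comm]
    have q : {a, d} ∈ F ∧ {a, e} ∈ F := by
      by_contra q
      have : F.card ≤ 1 := card_le_one.2 fun X hX Y hY => by
        have := hsub X hX
        have := hsub Y hY
        grind
      omega
    have := mem_or_eq_of_adjacent_pairs hG hcross' q.1 q.2 hde
    refine card_add_card_le_of_star (S := {d, e}) hF hG hmeet ha fun X hX => ?_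
    rcases mem_union.1 hX with h | h
    · rcases hsub X h with rfl | rfl <;> simp
    · exact this X h

/-- A family of pairwise disjoint sets, all meeting a fixed pair, has at most two members. -/
lemma card_le_two_of_pairwise_disjoint {G : Finset (Finset ℕ)} {x y : ℕ}
    (hmeet : ∀ A ∈ G, (({x, y} : Finset ℕ) ∩ A).Nonempty)
    (hdisj : ∀ A ∈ G, ∀ B ∈ G, A ≠ B → Disjoint A B) : G.card ≤ 2 := by
  by_contra! h
  obtain ⟨A, B, C, hA, hB, hC, hAB, hAC, hBC⟩ := two_lt_card_iff.1 h
  have key : ∀ A ∈ G, x ∈ A ∨ y ∈ A := fun A hA => by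
    obtain ⟨z, hz⟩ := hmeet A hA
    simp only [mem_inter, mem_insert, mem_singleton] at hz
    grind
  have dAB := disjoint_left.1 (hdisj A hA B hB hAB)
  have dAC := disjoint_left.1 (hdisj A hA C hC hAC)
  have dBC := disjoint_left.1 (hdisj B hB C hC hBC)
  have := key A hA
  have := key B hB
  have := key C hC
  grind

/-- If `ℱ, 𝒢 ⊆ ([n] choose 2)` are cross-intersecting families with
`|ℱ ∩ 𝒢| ≤ 1`, `|ℱ| ≥ 2` and `|𝒢| ≥ 2`, then
`|ℱ| + |𝒢| ≤ C(n,2) − C(n−2,2) − C(n−3,1) + 1`. -/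
theorem stmt_16 (n : ℕ) (hn : 5 ≤ n)
    (F G : Finset (Finset ℕ))
    (hF : F ⊆ powersetCard 2 (Icc 1 n))
    (hG : G ⊆ powersetCard 2 (Icc 1 n))
    (hcross : ∀ A ∈ F, ∀ B ∈ G, (A ∩ B).Nonempty)
    (hmeet : (F ∩ G).card ≤ 1)
    (hF2 : 2 ≤ F.card) (hG2 : 2 ≤ G.card) :
    (F.card : ℤ) + G.card ≤
      (n.choose 2 : ℤ) - (n - 2).choose 2 - (n - 3).choose 1 + 1 := by
  have main : F.card + G.card ≤ n + 1 := by
    by_cases hdisj : ∀ A ∈ G, ∀ B ∈ G, A ≠ B → Disjoint A B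
    · obtain ⟨X, hX⟩ := card_pos.1 (by omega : 0 < F.card)
      obtain ⟨x, y, -, rfl⟩ := card_eq_two.1 (mem_powersetCard.1 (hF hX)).2
      have hGc := card_le_two_of_pairwise_disjoint (hcross _ hX) hdisj
      obtain ⟨A, hA, B, hB, hAB⟩ := one_lt_card.1 (by omega : 1 < G.card)
      have d := hdisj A hA B hB hAB
      obtain ⟨a, b, -, rfl⟩ := card_eq_two.1 (mem_powersetCard.1 (hG hA)).2
      obtain ⟨c, d', -, rfl⟩ := card_eq_two.1 (mem_powersetCard.1 (hG hB)).2
      simp only [disjoint_insert_left, disjoint_singleton_left, mem_insert, mem_singleton,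
        not_or] at d
      have := card_le_four_of_disjoint_pairs hF hcross hA hB d.1.1 d.1.2 d.2.1 d.2.2
      omega
    · push Not at hdisj
      obtain ⟨A, hA, B, hB, hAB, hd⟩ := hdisj
      rw [not_disjoint_iff_nonempty_inter] at hd
      obtain ⟨a, b, nab, rfl⟩ := card_eq_two.1 (mem_powersetCard.1 (hG hA)).2
      obtain ⟨c, d, ncd, rfl⟩ := card_eq_two.1 (mem_powersetCard.1 (hG hB)).2
      have go : ∀ {u v w : ℕ}, {u, v} ∈ G → {u, w} ∈ G → u ≠ v → u ≠ w → v ≠ w →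
          F.card + G.card ≤ n + 1 :=
        card_add_card_le_of_adjacent hn hF hG hcross hmeet hF2
      rcases pair_inter_nonempty hd with rfl | rfl | rfl | rfl
      · exact go hA hB nab ncd (by rintro rfl; exact hAB rfl)
      · rw [pair_comm c] at hB hAB
        exact go hA hB nab ncd.symm (by rintro rfl; exact hAB rfl)
      · rw [pair_comm a] at hA hAB
        exact go hA hB nab.symm ncd (by rintro rfl; exact hAB rfl)
      · rw [pair_comm a] at hA
        rw [pair_comm c] at hB
        exact go hA hB nab.symm ncd.symm (by rintro rfl; exact hAB rfl)
  obtain ⟨m, rfl⟩ := Nat.exists_eq_add_of_le' hn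
  have h : (m + 5).choose 2 = (m + 3).choose 2 + (2 * m + 7) := by
    have h1 : (m + 5).choose 2 = (m + 4).choose 1 + (m + 4).choose 2 :=
      Nat.choose_succ_succ' (m + 4) 1
    have h2 : (m + 4).choose 2 = (m + 3).choose 1 + (m + 3).choose 2 :=
      Nat.choose_succ_succ' (m + 3) 1
    rw [Nat.choose_one_right] at h1 h2
    omega
  rw [show m + 5 - 2 = m + 3 by omega, show m + 5 - 3 = m + 2 by omega, h,
    Nat.choose_one_right]
  push_cast
  omega
end

section
/- Let n ≥ 7 be an integer. Let ℱ ⊆ ([n] choose 3) and 𝒢 ⊆ ([n] choose 3) be non-empty cross-intersecting families with |ℱ ∩ 𝒢| ≤ 2, |ℱ| ≥ 3 and |𝒢| ≥ 3. Then |ℱ| + |𝒢| ≤ C(n,3) − C(n−3,3) − C(n−4,2) − C(n−5,1) + 2. -/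
open Finset

/-- The 3-element subsets of `Fin m` that meet both `c` and `d`. -/
def transversals {m : ℕ} (c d : Finset (Fin m)) : Finset (Finset (Fin m)) :=
  {P ∈ powersetCard 3 univ | ¬ Disjoint P c ∧ ¬ Disjoint P d}

/-- The subset of `Fin m` whose characteristic vector is the binary expansion of `k`. -/
def bitSet (m k : ℕ) : Finset (Fin m) :=
  {i | k.testBit i}

section Matching

variable {α ι : Type*} [DecidableEq α] [Fintype ι] {U V X Y : Finset α} {P Q : ι → α}

/-- A subset of `U` and an injective family in `U` overlap at least as much as their sizes force. -/
theorem card_add_card_filter_notMem_le (hX : X ⊆ U) (hP : P.Injective) (hPU : ∀ i, P i ∈ U) :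
    #X + #{i | P i ∉ X} ≤ #U := by
  have hdis : Disjoint X (image P {i | P i ∉ X}) := by
    rw [disjoint_right]
    intro a ha
    obtain ⟨i, hi, rfl⟩ := mem_image.1 ha
    exact (mem_filter.1 hi).2
  rw [← card_image_of_injective _ hP, ← card_union_of_disjoint hdis]
  refine card_le_card (union_subset hX fun a ha ↦ ?_)
  obtain ⟨i, -, rfl⟩ := mem_image.1 ha
  exact hPU i

/-- A matching of disjoint pairs bounds the size of a pair of cross-intersecting families. -/
theorem card_add_card_add_le_of_matching (hX : X ⊆ U) (hY : Y ⊆ V)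
    (hP : P.Injective) (hQ : Q.Injective) (hPU : ∀ i, P i ∈ U) (hQV : ∀ i, Q i ∈ V)
    (hPQ : ∀ i, ¬ (P i ∈ X ∧ Q i ∈ Y)) :
    #X + #Y + (Fintype.card ι + #{i | P i ∉ X ∧ Q i ∉ Y}) ≤ #U + #V := by
  have h1 := card_add_card_filter_notMem_le hX hP hPU
  have h2 := card_add_card_filter_notMem_le hY hQ hQV
  classical
  have h3 : #{i | P i ∉ X ∨ Q i ∉ Y} + #{i | P i ∉ X ∧ Q i ∉ Y}
      = #{i | P i ∉ X} + #{i | Q i ∉ Y} := by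
    rw [filter_or, filter_and, card_union_add_card_inter]
  have h4 : ({i | P i ∉ X ∨ Q i ∉ Y} : Finset ι) = univ :=
    filter_true_of_mem fun i _ ↦ not_and_or.1 (hPQ i)
  rw [h4, card_univ] at h3
  lia

end Matching

theorem card_add_card_le_of_matching {m : ℕ} {ι : Type*} [Fintype ι]
    {U V X Y : Finset (Finset (Fin m))} (hX : X ⊆ U) (hY : Y ⊆ V)
    (hXY : ∀ P ∈ X, ∀ Q ∈ Y, ¬ Disjoint P Q) (P Q : ι → Finset (Fin m))
    (hP : P.Injective) (hQ : Q.Injective) (hPU : ∀ i, P i ∈ U) (hQV : ∀ i, Q i ∈ V)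
    (hPQ : ∀ i, Disjoint (P i) (Q i)) :
    #X + #Y + Fintype.card ι ≤ #U + #V := by
  have := card_add_card_add_le_of_matching hX hY hP hQ hPU hQV
    fun i h ↦ hXY _ h.1 _ h.2 (hPQ i)
  lia

theorem forall_of_forall_add_one {k : ℕ} {p : Fin (k + 1) → Prop} (h : ∀ i, p i → p (i + 1))
    {i : Fin (k + 1)} (hi : p i) (j : Fin (k + 1)) : p j := by
  have hadd : ∀ t : ℕ, p (i + Fin.ofNat (k + 1) t) := by
    intro t
    induction t with
    | zero => simpa using hi
    | succ t ih =>
      convert h _ ih using 1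
      rw [add_assoc]
      congr 1
      ext
      simp [Fin.val_add]
  simpa using hadd (j - i).val

/-- If the disjointness graph contains a cycle missing few vertices on either side, then
a pair of cross-intersecting families that is not too small cannot attain the matching bound. -/
theorem card_add_card_lt_of_cycle {m k : ℕ}
    {U V X Y : Finset (Finset (Fin m))} (hX : X ⊆ U) (hY : Y ⊆ V)
    (hXY : ∀ P ∈ X, ∀ Q ∈ Y, ¬ Disjoint P Q) (P Q : Fin (k + 1) → Finset (Fin m))
    (hP : P.Injective) (hQ : Q.Injective) (hPU : ∀ i, P i ∈ U) (hQV : ∀ i, Q i ∈ V)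
    (hPQ : ∀ i, Disjoint (P i) (Q i)) (hQP : ∀ i, Disjoint (P (i + 1)) (Q i))
    (hXU : #U < #X + Fintype.card (Fin (k + 1))) (hYV : #V < #Y + Fintype.card (Fin (k + 1))) :
    #X + #Y + Fintype.card (Fin (k + 1)) < #U + #V := by
  have hle := card_add_card_add_le_of_matching hX hY hP hQ hPU hQV
    fun i h ↦ hXY _ h.1 _ h.2 (hPQ i)
  by_contra hcon
  have hexact : ∀ i, P i ∉ X → Q i ∈ Y := by
    intro i hi
    by_contra hi'
    have : 0 < #{i | P i ∉ X ∧ Q i ∉ Y} := card_pos.2 ⟨i, by simp [hi, hi']⟩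
    lia
  have hstep : ∀ i, P i ∉ X → P (i + 1) ∉ X := fun i hi hi' ↦
    hXY _ hi' _ (hexact i hi) (hQP i)
  by_cases hall : ∃ i, P i ∉ X
  · obtain ⟨i, hi⟩ := hall
    have := card_add_card_filter_notMem_le hX hP hPU
    rw [filter_true_of_mem fun j _ ↦ forall_of_forall_add_one hstep hi j, card_univ] at this
    lia
  · push Not at hall
    have := card_add_card_filter_notMem_le hY hQ hQV
    rw [filter_true_of_mem (p := fun j ↦ Q j ∉ Y) fun j _ h ↦ hXY _ (hall j) _ h (hPQ j),
      card_univ] at this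
    lia

theorem card_transversals_7 :
    #(transversals {0, 1, 2} {3, 4, 5} : Finset (Finset (Fin 7))) = 27 := by
  decide +kernel

theorem card_transversals_7_six :
    #(transversals {0, 3, 2} {1, 4, 5} : Finset (Finset (Fin 7))) = 27 := by
  decide +kernel

theorem card_add_card_le_7_of_span_six
    {X Y : Finset (Finset (Fin 7))}
    (hX : X ⊆ transversals {0, 3, 2} {1, 4, 5}) (hY : Y ⊆ transversals {0, 1, 2} {3, 4, 5})
    (hXY : ∀ P ∈ X, ∀ Q ∈ Y, ¬ Disjoint P Q) (hX3 : 3 ≤ #X) (hY3 : 3 ≤ #Y) :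
    #X + #Y ≤ 28 := by
  have key := card_add_card_lt_of_cycle (k := 24) hX hY hXY
    (fun i ↦ bitSet 7 <| List.get
      [11, 67, 35, 19, 81, 21, 28, 84, 22, 26, 25, 88, 74, 104, 44, 41, 97, 49, 37, 100, 52, 38,
       70, 14, 42] i)
    (fun i ↦ bitSet 7 <| List.get
      [52, 28, 76, 44, 42, 98, 35, 41, 97, 100, 38, 37, 21, 19, 82, 22, 14, 74, 26, 11, 73, 25,
       49, 81, 84] i)
    (by decide +kernel) (by decide +kernel) (by decide +kernel) (by decide +kernel)
    (by decide +kernel) (by decide +kernel)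
    (by rw [card_transversals_7_six, Fintype.card_fin]; lia)
    (by rw [card_transversals_7, Fintype.card_fin]; lia)
  rw [card_transversals_7_six, card_transversals_7, Fintype.card_fin] at key
  lia

theorem card_transversals_7_seven :
    #(transversals {0, 3, 2} {1, 4, 6} : Finset (Finset (Fin 7))) = 27 := by
  decide +kernel

theorem card_add_card_le_7_of_span_seven
    {X Y : Finset (Finset (Fin 7))}
    (hX : X ⊆ transversals {0, 3, 2} {1, 4, 6}) (hY : Y ⊆ transversals {0, 1, 2} {3, 4, 5})
    (hXY : ∀ P ∈ X, ∀ Q ∈ Y, ¬ Disjoint P Q) (hX3 : 3 ≤ #X) (hY3 : 3 ≤ #Y) :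
    #X + #Y ≤ 28 := by
  have key := card_add_card_lt_of_cycle (k := 24) hX hY hXY
    (fun i ↦ bitSet 7 <| List.get
      [11, 42, 104, 76, 69, 100, 70, 22, 38, 14, 74, 26, 28, 88, 25, 21, 84, 52, 49, 35, 67, 73,
       97, 81, 19] i)
    (fun i ↦ bitSet 7 <| List.get
      [84, 21, 19, 50, 26, 25, 41, 73, 81, 49, 37, 97, 35, 38, 98, 42, 11, 74, 76, 28, 52, 22,
       14, 44, 100] i)
    (by decide +kernel) (by decide +kernel) (by decide +kernel) (by decide +kernel)
    (by decide +kernel) (by decide +kernel)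
    (by rw [card_transversals_7_seven, Fintype.card_fin]; lia)
    (by rw [card_transversals_7, Fintype.card_fin]; lia)
  rw [card_transversals_7_seven, card_transversals_7, Fintype.card_fin] at key
  lia

theorem card_transversals_8 :
    #(transversals {0, 1, 2} {3, 4, 5} : Finset (Finset (Fin 8))) = 36 := by
  decide +kernel

theorem card_transversals_8_six :
    #(transversals {0, 3, 2} {1, 4, 5} : Finset (Finset (Fin 8))) = 36 := by
  decide +kernel

theorem card_add_card_le_8_of_span_six
    {X Y : Finset (Finset (Fin 8))}
    (hX : X ⊆ transversals {0, 3, 2} {1, 4, 5}) (hY : Y ⊆ transversals {0, 1, 2} {3, 4, 5})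
    (hXY : ∀ P ∈ X, ∀ Q ∈ Y, ¬ Disjoint P Q) :
    #X + #Y ≤ 38 := by
  have key := card_add_card_le_of_matching (ι := Fin 34) hX hY hXY
    (fun i ↦ bitSet 8 <| List.get
      [11, 19, 35, 67, 131, 21, 37, 25, 41, 49, 81, 145, 97, 161, 14, 22, 38, 70, 134, 26, 42,
       74, 138, 28, 44, 52, 84, 148, 100, 164, 88, 152, 104, 168] i)
    (fun i ↦ bitSet 8 <| List.get
      [100, 76, 148, 52, 28, 42, 26, 164, 146, 14, 140, 44, 22, 82, 161, 41, 73, 25, 49, 97, 81,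
       37, 84, 162, 145, 138, 35, 74, 137, 11, 38, 98, 21, 19] i)
    (by decide +kernel) (by decide +kernel) (by decide +kernel) (by decide +kernel)
    (by decide +kernel)
  rw [card_transversals_8_six, card_transversals_8, Fintype.card_fin] at key
  lia

theorem card_transversals_8_seven :
    #(transversals {0, 3, 2} {1, 4, 6} : Finset (Finset (Fin 8))) = 36 := by
  decide +kernel

theorem card_add_card_le_8_of_span_seven
    {X Y : Finset (Finset (Fin 8))}
    (hX : X ⊆ transversals {0, 3, 2} {1, 4, 6}) (hY : Y ⊆ transversals {0, 1, 2} {3, 4, 5})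
    (hXY : ∀ P ∈ X, ∀ Q ∈ Y, ¬ Disjoint P Q) :
    #X + #Y ≤ 38 := by
  have key := card_add_card_le_of_matching (ι := Fin 34) hX hY hXY
    (fun i ↦ bitSet 8 <| List.get
      [11, 19, 35, 67, 131, 21, 69, 25, 73, 49, 81, 145, 97, 193, 14, 22, 38, 70, 134, 26, 42,
       74, 138, 28, 76, 52, 84, 148, 100, 196, 88, 152, 104, 200] i)
    (fun i ↦ bitSet 8 <| List.get
      [84, 44, 140, 28, 52, 162, 26, 98, 146, 76, 42, 14, 138, 22, 97, 137, 145, 49, 81, 100,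
       148, 164, 37, 161, 50, 74, 11, 73, 25, 41, 38, 35, 21, 19] i)
    (by decide +kernel) (by decide +kernel) (by decide +kernel) (by decide +kernel)
    (by decide +kernel)
  rw [card_transversals_8_seven, card_transversals_8, Fintype.card_fin] at key
  lia

theorem card_transversals_8_eight :
    #(transversals {0, 3, 6} {1, 4, 7} : Finset (Finset (Fin 8))) = 36 := by
  decide +kernel

theorem card_add_card_le_8_of_span_eight
    {X Y : Finset (Finset (Fin 8))}
    (hX : X ⊆ transversals {0, 3, 6} {1, 4, 7}) (hY : Y ⊆ transversals {0, 1, 2} {3, 4, 5})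
    (hXY : ∀ P ∈ X, ∀ Q ∈ Y, ¬ Disjoint P Q) :
    #X + #Y ≤ 38 := by
  have key := card_add_card_le_of_matching (ι := Fin 34) hX hY hXY
    (fun i ↦ bitSet 8 <| List.get
      [11, 19, 35, 67, 131, 21, 133, 25, 137, 49, 81, 145, 161, 193, 14, 70, 26, 42, 74, 138,
       82, 98, 194, 28, 140, 84, 196, 88, 152, 168, 200, 112, 208, 224] i)
    (fun i ↦ bitSet 8 <| List.get
      [84, 140, 148, 44, 76, 42, 26, 100, 50, 74, 138, 14, 22, 38, 49, 25, 164, 81, 161, 52, 13,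
       145, 28, 98, 97, 41, 19, 162, 37, 82, 21, 137, 35, 11] i)
    (by decide +kernel) (by decide +kernel) (by decide +kernel) (by decide +kernel)
    (by decide +kernel)
  rw [card_transversals_8_eight, card_transversals_8, Fintype.card_fin] at key
  lia

theorem card_transversals_9 :
    #(transversals {0, 1, 2} {3, 4, 5} : Finset (Finset (Fin 9))) = 45 := by
  decide +kernel

theorem card_transversals_9_six :
    #(transversals {0, 3, 2} {1, 4, 5} : Finset (Finset (Fin 9))) = 45 := by
  decide +kernel

theorem card_add_card_le_9_of_span_six
    {X Y : Finset (Finset (Fin 9))}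
    (hX : X ⊆ transversals {0, 3, 2} {1, 4, 5}) (hY : Y ⊆ transversals {0, 1, 2} {3, 4, 5})
    (hXY : ∀ P ∈ X, ∀ Q ∈ Y, ¬ Disjoint P Q) :
    #X + #Y ≤ 47 := by
  have key := card_add_card_le_of_matching (ι := Fin 43) hX hY hXY
    (fun i ↦ bitSet 9 <| List.get
      [11, 19, 35, 67, 131, 259, 21, 37, 25, 41, 49, 81, 145, 273, 97, 161, 289, 14, 22, 38, 70,
       134, 262, 26, 42, 74, 138, 266, 28, 44, 52, 84, 148, 276, 100, 164, 292, 88, 152, 280,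
       104, 168, 296] i)
    (fun i ↦ bitSet 9 <| List.get
      [84, 268, 28, 148, 100, 140, 42, 74, 164, 274, 138, 14, 44, 98, 146, 22, 76, 49, 41, 273,
       25, 73, 137, 292, 276, 52, 81, 97, 162, 82, 266, 161, 289, 35, 265, 26, 11, 290, 38, 37,
       145, 21, 19] i)
    (by decide +kernel) (by decide +kernel) (by decide +kernel) (by decide +kernel)
    (by decide +kernel)
  rw [card_transversals_9_six, card_transversals_9, Fintype.card_fin] at key
  lia

theorem card_transversals_9_seven :
    #(transversals {0, 3, 2} {1, 4, 6} : Finset (Finset (Fin 9))) = 45 := by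
  decide +kernel

theorem card_add_card_le_9_of_span_seven
    {X Y : Finset (Finset (Fin 9))}
    (hX : X ⊆ transversals {0, 3, 2} {1, 4, 6}) (hY : Y ⊆ transversals {0, 1, 2} {3, 4, 5})
    (hXY : ∀ P ∈ X, ∀ Q ∈ Y, ¬ Disjoint P Q) :
    #X + #Y ≤ 47 := by
  have key := card_add_card_le_of_matching (ι := Fin 43) hX hY hXY
    (fun i ↦ bitSet 9 <| List.get
      [11, 19, 35, 67, 131, 259, 21, 69, 25, 73, 49, 81, 145, 273, 97, 193, 321, 14, 22, 38, 70,
       134, 262, 26, 42, 74, 138, 266, 28, 76, 52, 84, 148, 276, 100, 196, 324, 88, 152, 280,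
       104, 200, 328] i)
    (fun i ↦ bitSet 9 <| List.get
      [84, 268, 148, 52, 76, 28, 290, 42, 164, 274, 140, 14, 44, 38, 138, 22, 146, 273, 97, 265,
       25, 73, 49, 292, 276, 21, 100, 81, 162, 50, 74, 266, 289, 137, 26, 11, 41, 161, 98, 37,
       145, 35, 19] i)
    (by decide +kernel) (by decide +kernel) (by decide +kernel) (by decide +kernel)
    (by decide +kernel)
  rw [card_transversals_9_seven, card_transversals_9, Fintype.card_fin] at key
  lia

theorem card_transversals_9_eight :
    #(transversals {0, 3, 6} {1, 4, 7} : Finset (Finset (Fin 9))) = 45 := by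
  decide +kernel

theorem card_add_card_le_9_of_span_eight
    {X Y : Finset (Finset (Fin 9))}
    (hX : X ⊆ transversals {0, 3, 6} {1, 4, 7}) (hY : Y ⊆ transversals {0, 1, 2} {3, 4, 5})
    (hXY : ∀ P ∈ X, ∀ Q ∈ Y, ¬ Disjoint P Q) :
    #X + #Y ≤ 47 := by
  have key := card_add_card_le_of_matching (ι := Fin 43) hX hY hXY
    (fun i ↦ bitSet 9 <| List.get
      [11, 19, 35, 67, 131, 259, 21, 133, 25, 137, 49, 81, 145, 273, 161, 193, 385, 14, 70, 26,
       42, 74, 138, 266, 82, 98, 194, 322, 28, 140, 84, 196, 88, 152, 280, 168, 200, 392, 112,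
       208, 336, 224, 448] i)
    (fun i ↦ bitSet 9 <| List.get
      [276, 268, 28, 44, 52, 140, 138, 266, 292, 274, 76, 162, 98, 38, 26, 22, 74, 145, 137,
       100, 84, 148, 81, 49, 289, 265, 25, 21, 161, 50, 42, 41, 164, 290, 97, 273, 35, 82, 14,
       37, 13, 19, 11] i)
    (by decide +kernel) (by decide +kernel) (by decide +kernel) (by decide +kernel)
    (by decide +kernel)
  rw [card_transversals_9_eight, card_transversals_9, Fintype.card_fin] at key
  lia

theorem exists_eq_insert_insert_of_card_eq_three {α : Type*} [DecidableEq α] {S : Finset α}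
    (hS : #S = 3) {x y : α} (hx : x ∈ S) (hy : y ∈ S) (hxy : x ≠ y) :
    ∃ z, z ≠ x ∧ z ≠ y ∧ S = {x, y, z} := by
  have hcard : #((S.erase x).erase y) = 1 := by
    rw [card_erase_of_mem (mem_erase.2 ⟨hxy.symm, hy⟩), card_erase_of_mem hx, hS]
  obtain ⟨z, hz⟩ := card_eq_one.1 hcard
  have hz' : z ∈ (S.erase x).erase y := by simp [hz]
  simp only [mem_erase] at hz'
  refine ⟨z, hz'.2.1, hz'.1, ?_⟩
  rw [← hz, insert_erase (mem_erase.2 ⟨hxy.symm, hy⟩), insert_erase hx]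

/-- The members of `F` that lie in the range of `φ`, pulled back along `φ`. -/
def pullback {m : ℕ} (φ : Fin m ↪ ℕ) (F : Finset (Finset ℕ)) : Finset (Finset (Fin m)) :=
  {P | P.map φ ∈ F}

section Pullback

variable {n m : ℕ} {F G : Finset (Finset ℕ)} {φ : Fin m ↪ ℕ} {c d : Finset (Fin m)}

theorem pullback_subset_transversals (hF : F ⊆ powersetCard 3 (Icc 1 n))
    (hc : ∀ S ∈ F, (S ∩ c.map φ).Nonempty) (hd : ∀ S ∈ F, (S ∩ d.map φ).Nonempty) :
    pullback φ F ⊆ transversals c d := by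
  intro P hP
  have hP' : P.map φ ∈ F := by simpa [pullback] using hP
  have hcard := (mem_powersetCard.1 (hF hP')).2
  have h1 := hc _ hP'
  have h2 := hd _ hP'
  rw [← map_inter, map_nonempty] at h1 h2
  rw [card_map] at hcard
  simp [transversals, mem_powersetCard, hcard, not_disjoint_iff_nonempty_inter, h1, h2]

theorem not_disjoint_of_mem_pullback (hcross : ∀ A ∈ F, ∀ B ∈ G, (A ∩ B).Nonempty) :
    ∀ P ∈ pullback φ F, ∀ Q ∈ pullback φ G, ¬ Disjoint P Q := by
  intro P hP Q hQ
  have := hcross _ (mem_filter.1 hP).2 _ (mem_filter.1 hQ).2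
  rwa [← map_inter, map_nonempty, ← not_disjoint_iff_nonempty_inter] at this

theorem card_le_card_pullback_add (hF : F ⊆ powersetCard 3 (Icc 1 n)) (hφ : ∀ i, φ i ∈ Icc 1 n)
    (hc3 : #c = 3) (hd3 : #d = 3) (hcd : Disjoint c d)
    (hc : ∀ S ∈ F, (S ∩ c.map φ).Nonempty) (hd : ∀ S ∈ F, (S ∩ d.map φ).Nonempty) :
    #F ≤ #(pullback φ F) + 9 * (n - m) := by
  have hsub : F ⊆ (pullback φ F).image (fun P ↦ P.map φ) ∪
      (c ×ˢ d ×ˢ (Icc 1 n \ univ.map φ)).image (fun t ↦ {φ t.1, φ t.2.1, t.2.2}) := by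
    intro S hS
    obtain ⟨x', hx⟩ := hc S hS
    obtain ⟨y', hy⟩ := hd S hS
    obtain ⟨hxS, hx⟩ := mem_inter.1 hx
    obtain ⟨hyS, hy⟩ := mem_inter.1 hy
    obtain ⟨x, hxc, rfl⟩ := mem_map.1 hx
    obtain ⟨y, hyd, rfl⟩ := mem_map.1 hy
    obtain ⟨hSn, hS3⟩ := mem_powersetCard.1 (hF hS)
    have hxy : φ x ≠ φ y := fun h ↦ disjoint_left.1 hcd hxc (φ.injective h ▸ hyd)
    obtain ⟨z, -, -, rfl⟩ := exists_eq_insert_insert_of_card_eq_three hS3 hxS hyS hxy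
    rw [mem_union]
    by_cases hz : z ∈ univ.map φ
    · left
      obtain ⟨z, -, rfl⟩ := mem_map.1 hz
      have hmap : map φ {x, y, z} = {φ x, φ y, φ z} := by simp [map_insert]
      exact mem_image.2 ⟨{x, y, z}, by simpa [pullback, hmap] using hS, hmap⟩
    · right
      refine mem_image.2 ⟨(x, y, z), ?_, rfl⟩
      simp only [mem_product, mem_sdiff]
      exact ⟨hxc, hyd, hSn (by simp), hz⟩
  have hcard : #(Icc 1 n \ univ.map φ) = n - m := by
    rw [card_sdiff_of_subset (fun z hz ↦ by obtain ⟨i, -, rfl⟩ := mem_map.1 hz; exact hφ i)]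
    simp
  calc #F ≤ _ := card_le_card hsub
    _ ≤ _ := card_union_le _ _
    _ ≤ _ := Nat.add_le_add card_image_le card_image_le
    _ = _ := by rw [card_product, card_product, hc3, hd3, hcard]; ring

end Pullback

theorem exists_embedding_extending_list {n m : ℕ} (hmn : m ≤ n) (l : List ℕ) (hl : l.Nodup)
    (hln : ∀ x ∈ l, x ∈ Icc 1 n) (hlm : l.length ≤ m) :
    ∃ φ : Fin m ↪ ℕ, (∀ i, φ i ∈ Icc 1 n) ∧
      ∀ i (hi : i < l.length), φ ⟨i, hi.trans_le hlm⟩ = l[i] := by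
  have hcard : m - l.length ≤ #(Icc 1 n \ l.toFinset) := by
    rw [card_sdiff_of_subset (fun x hx ↦ hln x (List.mem_toFinset.1 hx)),
      List.toFinset_card_of_nodup hl, Nat.card_Icc]
    lia
  obtain ⟨s, hs, hscard⟩ := exists_subset_card_eq hcard
  have hlen : (l ++ s.toList).length = m := by simp [hscard, hlm]
  have hnodup : (l ++ s.toList).Nodup := by
    refine List.nodup_append'.2 ⟨hl, s.nodup_toList, fun x hx hx' ↦ ?_⟩
    exact (mem_sdiff.1 (hs (mem_toList.1 hx'))).2 (List.mem_toFinset.2 hx)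
  refine ⟨⟨fun i ↦ (l ++ s.toList)[i]'(by rw [hlen]; exact i.2), fun i j hij ↦ ?_⟩, ?_, ?_⟩
  · exact Fin.ext ((hnodup.getElem_inj_iff).1 hij)
  · intro i
    have hmem : (l ++ s.toList)[i]'(by rw [hlen]; exact i.2) ∈ l ++ s.toList :=
      List.getElem_mem _
    rcases List.mem_append.1 hmem with h | h
    · exact hln _ h
    · exact (mem_sdiff.1 (hs (mem_toList.1 h))).1
  · intro i hi
    exact List.getElem_append_left hi

theorem choose_three_eq (k : ℕ) :
    (k + 5).choose 3 = (k + 2).choose 3 + (k + 1).choose 2 + k.choose 1 + ((k + 3) ^ 2 + 1) := by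
  have h : 2 * k.choose 2 + k = k ^ 2 := by
    induction k with
    | zero => rfl
    | succ k ih =>
      rw [Nat.choose_succ_succ' k 1, Nat.choose_one_right]
      nlinarith
  simp only [Nat.choose_succ_succ', Nat.choose_zero_right, Nat.choose_one_right,
    zero_add, Nat.reduceAdd]
  nlinarith

theorem card_union_add_le_of_intersecting {n : ℕ} (hn : 7 ≤ n) {F G : Finset (Finset ℕ)}
    (hF : F ⊆ powersetCard 3 (Icc 1 n)) (hG : G ⊆ powersetCard 3 (Icc 1 n))
    (hcross : ∀ A ∈ F, ∀ B ∈ G, (A ∩ B).Nonempty) (hF3 : 3 ≤ #F)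
    (hint : ∀ A ∈ F, ∀ B ∈ F, (A ∩ B).Nonempty) :
    #(F ∪ G) + ((n - 3).choose 3 + (n - 4).choose 2 + (n - 5)) ≤ n.choose 3 := by
  obtain ⟨X, hX, Y, hY, Z, hZ, hXY, hXZ, hYZ⟩ := two_lt_card.1 hF3
  obtain ⟨hXn, hX3⟩ := mem_powersetCard.1 (hF hX)
  obtain ⟨hYn, hY3⟩ := mem_powersetCard.1 (hF hY)
  obtain ⟨hZn, hZ3⟩ := mem_powersetCard.1 (hF hZ)
  have exists_mem_notMem : ∀ {S T : Finset ℕ}, #S = 3 → #T = 3 → S ≠ T → ∃ x ∈ S, x ∉ T := by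
    intro S T hS hT hST
    exact not_subset.1 fun h ↦ hST (eq_of_subset_of_card_le h (by lia))
  obtain ⟨x, hxX, hxY⟩ := exists_mem_notMem hX3 hY3 hXY
  obtain ⟨u, v, hu, hv, huv, huZ, hvZ, huX, huvY⟩ : ∃ u v, u ∈ Icc 1 n ∧ v ∈ Icc 1 n ∧ u ≠ v ∧
      u ∉ Z ∧ v ∉ Z ∧ u ∈ X ∧ (u ∈ Y ∨ v ∈ Y) := by
    obtain ⟨u, huX, huZ⟩ := exists_mem_notMem hX3 hZ3 hXZ
    obtain ⟨v, hvY, hvZ⟩ := exists_mem_notMem hY3 hZ3 hYZ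
    by_cases huv : u = v
    · have hpos : 0 < #(Icc 1 n \ insert u Z) := by
        have h1 := le_card_sdiff (insert u Z) (Icc 1 n)
        have h2 := card_insert_le u Z
        rw [Nat.card_Icc] at h1
        lia
      obtain ⟨w, hw⟩ := card_pos.1 hpos
      simp only [mem_sdiff, mem_insert, not_or] at hw
      exact ⟨u, w, hXn huX, hw.1, Ne.symm hw.2.1, huZ, hw.2.2, huX, .inl (huv ▸ hvY)⟩
    · exact ⟨u, v, hXn huX, hYn hvY, huv, huZ, hvZ, huX, .inr hvY⟩
  set P₁ := powersetCard 3 (Icc 1 n \ X) with hP₁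
  set P₂ := (powersetCard 2 (Icc 1 n \ insert x Y)).image (insert x) with hP₂
  set P₃ := (Icc 1 n \ insert u (insert v Z)).image (fun w ↦ ({u, v, w} : Finset ℕ)) with hP₃
  have hc₁ : #P₁ = (n - 3).choose 3 := by
    rw [hP₁, card_powersetCard, card_sdiff_of_subset hXn, hX3, Nat.card_Icc, Nat.add_sub_cancel]
  have hc₂ : #P₂ = (n - 4).choose 2 := by
    rw [hP₂, card_image_of_injOn, card_powersetCard,
      card_sdiff_of_subset (insert_subset (hXn hxX) hYn), card_insert_of_notMem hxY, hY3,
      Nat.card_Icc, Nat.add_sub_cancel]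
    intro S hS T hT hST
    have hxn : ∀ {R : Finset ℕ}, R ∈ powersetCard 2 (Icc 1 n \ insert x Y) → x ∉ R :=
      fun hR hx ↦ (mem_sdiff.1 ((mem_powersetCard.1 hR).1 hx)).2 (mem_insert_self _ _)
    rw [← erase_insert (hxn hS), ← erase_insert (hxn hT)]
    exact congrArg (erase · x) hST
  have hc₃ : #P₃ = n - 5 := by
    rw [hP₃, card_image_of_injOn,
      card_sdiff_of_subset (insert_subset hu (insert_subset hv hZn)),
      card_insert_of_notMem (by simp [huv, huZ]), card_insert_of_notMem hvZ, hZ3,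
      Nat.card_Icc, Nat.add_sub_cancel]
    intro w hw w' hw' hww
    simp only [coe_sdiff, Set.mem_sdiff, mem_coe, mem_insert, not_or] at hw hw'
    have : w ∈ ({u, v, w'} : Finset ℕ) := by
      rw [← show ({u, v, w} : Finset ℕ) = {u, v, w'} from hww]
      simp
    simpa [hw.2.1, hw.2.2.1] using this
  have hm₁ : ∀ S ∈ P₁, S ∈ powersetCard 3 (Icc 1 n) ∧ Disjoint S X := fun S hS ↦ by
    obtain ⟨h, h3⟩ := mem_powersetCard.1 hS
    exact ⟨mem_powersetCard.2 ⟨h.trans sdiff_subset, h3⟩, disjoint_of_subset_left h sdiff_disjoint⟩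
  have hm₂ : ∀ S ∈ P₂, S ∈ powersetCard 3 (Icc 1 n) ∧ Disjoint S Y ∧ x ∈ S := fun S hS ↦ by
    obtain ⟨T, hT, rfl⟩ := mem_image.1 hS
    obtain ⟨h, h2⟩ := mem_powersetCard.1 hT
    have hxT : x ∉ T := fun hx ↦ (mem_sdiff.1 (h hx)).2 (mem_insert_self _ _)
    refine ⟨mem_powersetCard.2 ⟨insert_subset (hXn hxX) (h.trans sdiff_subset), ?_⟩, ?_,
      mem_insert_self _ _⟩
    · rw [card_insert_of_notMem hxT, h2]
    · rw [disjoint_insert_left]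
      exact ⟨hxY, (disjoint_insert_right.1 (disjoint_of_subset_left h sdiff_disjoint)).2⟩
  have hm₃ : ∀ S ∈ P₃, S ∈ powersetCard 3 (Icc 1 n) ∧ Disjoint S Z ∧ u ∈ S ∧ v ∈ S :=
    fun S hS ↦ by
    obtain ⟨w, hw, rfl⟩ := mem_image.1 hS
    simp only [mem_sdiff, mem_insert, not_or] at hw
    refine ⟨mem_powersetCard.2 ⟨?_, ?_⟩, ?_, by simp, by simp⟩
    · simp only [insert_subset_iff, singleton_subset_iff]
      exact ⟨hu, hv, hw.1⟩
    · exact card_eq_three.2 ⟨u, v, w, huv, Ne.symm hw.2.1, Ne.symm hw.2.2.1, rfl⟩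
    · simp [huZ, hvZ, hw.2.2.2]
  have hd₁₂ : Disjoint P₁ P₂ := disjoint_left.2 fun S h1 h2 ↦
    disjoint_left.1 (hm₁ S h1).2 (hm₂ S h2).2.2 hxX
  have hd₃ : Disjoint (P₁ ∪ P₂) P₃ := disjoint_left.2 fun S h12 h3 ↦ by
    obtain ⟨-, -, huS, hvS⟩ := hm₃ S h3
    rcases mem_union.1 h12 with h | h
    · exact disjoint_left.1 (hm₁ S h).2 huS huX
    · exact huvY.elim (disjoint_left.1 (hm₂ S h).2.1 huS) (disjoint_left.1 (hm₂ S h).2.1 hvS)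
  have hmiss : ∀ S ∈ P₁ ∪ P₂ ∪ P₃, S ∈ powersetCard 3 (Icc 1 n) ∧ ∃ T ∈ F, Disjoint T S := by
    intro S hS
    rcases mem_union.1 hS with hS | hS
    · rcases mem_union.1 hS with hS | hS
      · exact ⟨(hm₁ S hS).1, X, hX, (hm₁ S hS).2.symm⟩
      · exact ⟨(hm₂ S hS).1, Y, hY, (hm₂ S hS).2.1.symm⟩
    · exact ⟨(hm₃ S hS).1, Z, hZ, (hm₃ S hS).2.1.symm⟩
  have hd : Disjoint (F ∪ G) (P₁ ∪ P₂ ∪ P₃) := disjoint_right.2 fun S hS hFG ↦ by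
    obtain ⟨-, T, hT, hTS⟩ := hmiss S hS
    refine (mem_union.1 hFG).elim (fun h ↦ ?_) (fun h ↦ ?_)
    · exact not_disjoint_iff_nonempty_inter.2 (hint T hT S h) hTS
    · exact not_disjoint_iff_nonempty_inter.2 (hcross T hT S h) hTS
  have hfinal := card_le_card (union_subset (union_subset hF hG) fun S hS ↦ (hmiss S hS).1)
  rw [card_union_of_disjoint hd, card_union_of_disjoint hd₃, card_union_of_disjoint hd₁₂, hc₁, hc₂,
    hc₃, card_powersetCard, Nat.card_Icc, Nat.add_sub_cancel] at hfinal
  exact hfinal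

section Spans

variable {n : ℕ} {F G : Finset (Finset ℕ)}

theorem pullback_properties {m : ℕ} {φ : Fin m ↪ ℕ} {a b c d : Finset (Fin m)}
    (hF : F ⊆ powersetCard 3 (Icc 1 n)) (hG : G ⊆ powersetCard 3 (Icc 1 n))
    (hcross : ∀ A ∈ F, ∀ B ∈ G, (A ∩ B).Nonempty) (hφ : ∀ i, φ i ∈ Icc 1 n)
    (hab : Disjoint a b) (hcd : Disjoint c d)
    (ha : a.map φ ∈ F) (hb : b.map φ ∈ F) (hc : c.map φ ∈ G) (hd : d.map φ ∈ G) :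
    pullback φ F ⊆ transversals c d ∧ pullback φ G ⊆ transversals a b ∧
      #F ≤ #(pullback φ F) + 9 * (n - m) ∧ #G ≤ #(pullback φ G) + 9 * (n - m) := by
  have hGF : ∀ S ∈ F, ∀ T ∈ G, (T ∩ S).Nonempty := fun S hS T hT ↦
    inter_comm S T ▸ hcross S hS T hT
  have hcard : ∀ {H : Finset (Finset ℕ)}, H ⊆ powersetCard 3 (Icc 1 n) →
      ∀ {e : Finset (Fin m)}, e.map φ ∈ H → #e = 3 := fun hH e he ↦ by
    simpa using (mem_powersetCard.1 (hH he)).2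
  exact ⟨pullback_subset_transversals hF (fun S hS ↦ hcross S hS _ hc)
      (fun S hS ↦ hcross S hS _ hd),
    pullback_subset_transversals hG (hGF _ ha) (hGF _ hb),
    card_le_card_pullback_add hF hφ (hcard hG hc) (hcard hG hd) hcd (fun S hS ↦ hcross S hS _ hc)
      (fun S hS ↦ hcross S hS _ hd),
    card_le_card_pullback_add hG hφ (hcard hF ha) (hcard hF hb) hab (hGF _ ha) (hGF _ hb)⟩

theorem add_add_four_mul_le (hn : 9 ≤ n) {f g x y : ℕ} (hxy : x + y ≤ 47)
    (hf : f ≤ x + 9 * (n - 9)) (hg : g ≤ y + 9 * (n - 9)) : f + g + 4 * n ≤ n ^ 2 + 7 := by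
  obtain ⟨k, rfl⟩ := Nat.exists_eq_add_of_le hn
  rw [Nat.add_sub_cancel_left] at hf hg
  zify at *
  nlinarith [sq_nonneg ((k : ℤ) - 2)]

theorem card_add_card_le_of_span_six (hn : 7 ≤ n)
    (hF : F ⊆ powersetCard 3 (Icc 1 n)) (hG : G ⊆ powersetCard 3 (Icc 1 n))
    (hcross : ∀ A ∈ F, ∀ B ∈ G, (A ∩ B).Nonempty) (hF3 : 3 ≤ #F) (hG3 : 3 ≤ #G)
    {a₁ a₂ a₃ b₁ b₂ b₃ : ℕ} (hnodup : [a₁, a₂, a₃, b₁, b₂, b₃].Nodup)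
    (hA : {a₁, a₂, a₃} ∈ F) (hB : {b₁, b₂, b₃} ∈ F)
    (hC : {a₁, b₁, a₃} ∈ G) (hD : {a₂, b₂, b₃} ∈ G) :
    #F + #G + 4 * n ≤ n ^ 2 + 7 := by
  have hmem : ∀ x ∈ [a₁, a₂, a₃, b₁, b₂, b₃], x ∈ Icc 1 n := by
    have h1 := (mem_powersetCard.1 (hF hA)).1
    have h2 := (mem_powersetCard.1 (hF hB)).1
    simp only [insert_subset_iff, singleton_subset_iff] at h1 h2
    simp only [List.forall_mem_cons, List.not_mem_nil, false_imp_iff, implies_true]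
    tauto
  obtain rfl | rfl | hn9 : n = 7 ∨ n = 8 ∨ 9 ≤ n := by lia
  · obtain ⟨φ, hφ, hl⟩ := exists_embedding_extending_list (m := 7) le_rfl _ hnodup hmem (by simp)
    have hval : φ 0 = a₁ ∧ φ 1 = a₂ ∧ φ 2 = a₃ ∧ φ 3 = b₁ ∧ φ 4 = b₂ ∧ φ 5 = b₃ :=
      ⟨hl 0 (by simp), hl 1 (by simp), hl 2 (by simp), hl 3 (by simp),
        hl 4 (by simp), hl 5 (by simp)⟩
    obtain ⟨hX, hY, hXF, hYG⟩ := pullback_properties (a := {0, 1, 2}) (b := {3, 4, 5})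
      (c := {0, 3, 2}) (d := {1, 4, 5}) hF hG hcross hφ (by decide) (by decide)
      (by simpa [map_insert, hval]) (by simpa [map_insert, hval]) (by simpa [map_insert, hval])
      (by simpa [map_insert, hval])
    have hle := card_add_card_le_7_of_span_six hX hY (not_disjoint_of_mem_pullback hcross)
      (by lia) (by lia)
    lia
  · obtain ⟨φ, hφ, hl⟩ := exists_embedding_extending_list (m := 8) le_rfl _ hnodup hmem (by simp)
    have hval : φ 0 = a₁ ∧ φ 1 = a₂ ∧ φ 2 = a₃ ∧ φ 3 = b₁ ∧ φ 4 = b₂ ∧ φ 5 = b₃ :=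
      ⟨hl 0 (by simp), hl 1 (by simp), hl 2 (by simp), hl 3 (by simp),
        hl 4 (by simp), hl 5 (by simp)⟩
    obtain ⟨hX, hY, hXF, hYG⟩ := pullback_properties (a := {0, 1, 2}) (b := {3, 4, 5})
      (c := {0, 3, 2}) (d := {1, 4, 5}) hF hG hcross hφ (by decide) (by decide)
      (by simpa [map_insert, hval]) (by simpa [map_insert, hval]) (by simpa [map_insert, hval])
      (by simpa [map_insert, hval])
    have hle := card_add_card_le_8_of_span_six hX hY (not_disjoint_of_mem_pullback hcross)
    lia
  · obtain ⟨φ, hφ, hl⟩ := exists_embedding_extending_list (m := 9) hn9 _ hnodup hmem (by simp)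
    have hval : φ 0 = a₁ ∧ φ 1 = a₂ ∧ φ 2 = a₃ ∧ φ 3 = b₁ ∧ φ 4 = b₂ ∧ φ 5 = b₃ :=
      ⟨hl 0 (by simp), hl 1 (by simp), hl 2 (by simp), hl 3 (by simp),
        hl 4 (by simp), hl 5 (by simp)⟩
    obtain ⟨hX, hY, hXF, hYG⟩ := pullback_properties (a := {0, 1, 2}) (b := {3, 4, 5})
      (c := {0, 3, 2}) (d := {1, 4, 5}) hF hG hcross hφ (by decide) (by decide)
      (by simpa [map_insert, hval]) (by simpa [map_insert, hval]) (by simpa [map_insert, hval])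
      (by simpa [map_insert, hval])
    have hle := card_add_card_le_9_of_span_six hX hY (not_disjoint_of_mem_pullback hcross)
    exact add_add_four_mul_le hn9 hle hXF hYG

theorem card_add_card_le_of_span_seven (hn : 7 ≤ n)
    (hF : F ⊆ powersetCard 3 (Icc 1 n)) (hG : G ⊆ powersetCard 3 (Icc 1 n))
    (hcross : ∀ A ∈ F, ∀ B ∈ G, (A ∩ B).Nonempty) (hF3 : 3 ≤ #F) (hG3 : 3 ≤ #G)
    {a₁ a₂ a₃ b₁ b₂ b₃ d : ℕ} (hnodup : [a₁, a₂, a₃, b₁, b₂, b₃, d].Nodup)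
    (hA : {a₁, a₂, a₃} ∈ F) (hB : {b₁, b₂, b₃} ∈ F)
    (hC : {a₁, b₁, a₃} ∈ G) (hD : {a₂, b₂, d} ∈ G) :
    #F + #G + 4 * n ≤ n ^ 2 + 7 := by
  have hmem : ∀ x ∈ [a₁, a₂, a₃, b₁, b₂, b₃, d], x ∈ Icc 1 n := by
    have h1 := (mem_powersetCard.1 (hF hA)).1
    have h2 := (mem_powersetCard.1 (hF hB)).1
    have h4 := (mem_powersetCard.1 (hG hD)).1
    simp only [insert_subset_iff, singleton_subset_iff] at h1 h2 h4
    simp only [List.forall_mem_cons, List.not_mem_nil, false_imp_iff, implies_true]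
    tauto
  obtain rfl | rfl | hn9 : n = 7 ∨ n = 8 ∨ 9 ≤ n := by lia
  · obtain ⟨φ, hφ, hl⟩ := exists_embedding_extending_list (m := 7) le_rfl _ hnodup hmem (by simp)
    have hval : φ 0 = a₁ ∧ φ 1 = a₂ ∧ φ 2 = a₃ ∧ φ 3 = b₁ ∧ φ 4 = b₂ ∧ φ 5 = b₃ ∧
        φ 6 = d :=
      ⟨hl 0 (by simp), hl 1 (by simp), hl 2 (by simp), hl 3 (by simp),
        hl 4 (by simp), hl 5 (by simp), hl 6 (by simp)⟩
    obtain ⟨hX, hY, hXF, hYG⟩ := pullback_properties (a := {0, 1, 2}) (b := {3, 4, 5})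
      (c := {0, 3, 2}) (d := {1, 4, 6}) hF hG hcross hφ (by decide) (by decide)
      (by simpa [map_insert, hval]) (by simpa [map_insert, hval]) (by simpa [map_insert, hval])
      (by simpa [map_insert, hval])
    have hle := card_add_card_le_7_of_span_seven hX hY (not_disjoint_of_mem_pullback hcross)
      (by lia) (by lia)
    lia
  · obtain ⟨φ, hφ, hl⟩ := exists_embedding_extending_list (m := 8) le_rfl _ hnodup hmem (by simp)
    have hval : φ 0 = a₁ ∧ φ 1 = a₂ ∧ φ 2 = a₃ ∧ φ 3 = b₁ ∧ φ 4 = b₂ ∧ φ 5 = b₃ ∧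
        φ 6 = d :=
      ⟨hl 0 (by simp), hl 1 (by simp), hl 2 (by simp), hl 3 (by simp),
        hl 4 (by simp), hl 5 (by simp), hl 6 (by simp)⟩
    obtain ⟨hX, hY, hXF, hYG⟩ := pullback_properties (a := {0, 1, 2}) (b := {3, 4, 5})
      (c := {0, 3, 2}) (d := {1, 4, 6}) hF hG hcross hφ (by decide) (by decide)
      (by simpa [map_insert, hval]) (by simpa [map_insert, hval]) (by simpa [map_insert, hval])
      (by simpa [map_insert, hval])
    have hle := card_add_card_le_8_of_span_seven hX hY (not_disjoint_of_mem_pullback hcross)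
    lia
  · obtain ⟨φ, hφ, hl⟩ := exists_embedding_extending_list (m := 9) hn9 _ hnodup hmem (by simp)
    have hval : φ 0 = a₁ ∧ φ 1 = a₂ ∧ φ 2 = a₃ ∧ φ 3 = b₁ ∧ φ 4 = b₂ ∧ φ 5 = b₃ ∧
        φ 6 = d :=
      ⟨hl 0 (by simp), hl 1 (by simp), hl 2 (by simp), hl 3 (by simp),
        hl 4 (by simp), hl 5 (by simp), hl 6 (by simp)⟩
    obtain ⟨hX, hY, hXF, hYG⟩ := pullback_properties (a := {0, 1, 2}) (b := {3, 4, 5})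
      (c := {0, 3, 2}) (d := {1, 4, 6}) hF hG hcross hφ (by decide) (by decide)
      (by simpa [map_insert, hval]) (by simpa [map_insert, hval]) (by simpa [map_insert, hval])
      (by simpa [map_insert, hval])
    have hle := card_add_card_le_9_of_span_seven hX hY (not_disjoint_of_mem_pullback hcross)
    exact add_add_four_mul_le hn9 hle hXF hYG

theorem card_add_card_le_of_span_eight
    (hF : F ⊆ powersetCard 3 (Icc 1 n)) (hG : G ⊆ powersetCard 3 (Icc 1 n))
    (hcross : ∀ A ∈ F, ∀ B ∈ G, (A ∩ B).Nonempty)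
    {a₁ a₂ a₃ b₁ b₂ b₃ c d : ℕ} (hnodup : [a₁, a₂, a₃, b₁, b₂, b₃, c, d].Nodup)
    (hA : {a₁, a₂, a₃} ∈ F) (hB : {b₁, b₂, b₃} ∈ F)
    (hC : {a₁, b₁, c} ∈ G) (hD : {a₂, b₂, d} ∈ G) :
    #F + #G + 4 * n ≤ n ^ 2 + 7 := by
  have hmem : ∀ x ∈ [a₁, a₂, a₃, b₁, b₂, b₃, c, d], x ∈ Icc 1 n := by
    have h1 := (mem_powersetCard.1 (hF hA)).1
    have h2 := (mem_powersetCard.1 (hF hB)).1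
    have h3 := (mem_powersetCard.1 (hG hC)).1
    have h4 := (mem_powersetCard.1 (hG hD)).1
    simp only [insert_subset_iff, singleton_subset_iff] at h1 h2 h3 h4
    simp only [List.forall_mem_cons, List.not_mem_nil, false_imp_iff, implies_true]
    tauto
  have hn : 8 ≤ n := by
    have h := card_le_card (s := [a₁, a₂, a₃, b₁, b₂, b₃, c, d].toFinset) (t := Icc 1 n)
      fun x hx ↦ hmem x (List.mem_toFinset.1 hx)
    rw [List.toFinset_card_of_nodup hnodup, Nat.card_Icc] at h
    simpa using h
  obtain rfl | hn9 : n = 8 ∨ 9 ≤ n := by lia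
  · obtain ⟨φ, hφ, hl⟩ := exists_embedding_extending_list (m := 8) le_rfl _ hnodup hmem (by simp)
    have hval : φ 0 = a₁ ∧ φ 1 = a₂ ∧ φ 2 = a₃ ∧ φ 3 = b₁ ∧ φ 4 = b₂ ∧ φ 5 = b₃ ∧
        φ 6 = c ∧ φ 7 = d :=
      ⟨hl 0 (by simp), hl 1 (by simp), hl 2 (by simp), hl 3 (by simp),
        hl 4 (by simp), hl 5 (by simp), hl 6 (by simp), hl 7 (by simp)⟩
    obtain ⟨hX, hY, hXF, hYG⟩ := pullback_properties (a := {0, 1, 2}) (b := {3, 4, 5})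
      (c := {0, 3, 6}) (d := {1, 4, 7}) hF hG hcross hφ (by decide) (by decide)
      (by simpa [map_insert, hval]) (by simpa [map_insert, hval]) (by simpa [map_insert, hval])
      (by simpa [map_insert, hval])
    have hle := card_add_card_le_8_of_span_eight hX hY (not_disjoint_of_mem_pullback hcross)
    lia
  · obtain ⟨φ, hφ, hl⟩ := exists_embedding_extending_list (m := 9) hn9 _ hnodup hmem (by simp)
    have hval : φ 0 = a₁ ∧ φ 1 = a₂ ∧ φ 2 = a₃ ∧ φ 3 = b₁ ∧ φ 4 = b₂ ∧ φ 5 = b₃ ∧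
        φ 6 = c ∧ φ 7 = d :=
      ⟨hl 0 (by simp), hl 1 (by simp), hl 2 (by simp), hl 3 (by simp),
        hl 4 (by simp), hl 5 (by simp), hl 6 (by simp), hl 7 (by simp)⟩
    obtain ⟨hX, hY, hXF, hYG⟩ := pullback_properties (a := {0, 1, 2}) (b := {3, 4, 5})
      (c := {0, 3, 6}) (d := {1, 4, 7}) hF hG hcross hφ (by decide) (by decide)
      (by simpa [map_insert, hval]) (by simpa [map_insert, hval]) (by simpa [map_insert, hval])
      (by simpa [map_insert, hval])
    have hle := card_add_card_le_9_of_span_eight hX hY (not_disjoint_of_mem_pullback hcross)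
    exact add_add_four_mul_le hn9 hle hXF hYG

end Spans

theorem card_add_card_le_of_disjoint {n : ℕ} {F G : Finset (Finset ℕ)} (hn : 7 ≤ n)
    (hF : F ⊆ powersetCard 3 (Icc 1 n)) (hG : G ⊆ powersetCard 3 (Icc 1 n))
    (hcross : ∀ A ∈ F, ∀ B ∈ G, (A ∩ B).Nonempty) (hF3 : 3 ≤ #F) (hG3 : 3 ≤ #G)
    {A B C D : Finset ℕ} (hA : A ∈ F) (hB : B ∈ F) (hC : C ∈ G) (hD : D ∈ G)
    (hAB : Disjoint A B) (hCD : Disjoint C D) :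
    #F + #G + 4 * n ≤ n ^ 2 + 7 := by
  obtain ⟨a₁, h₁⟩ := hcross A hA C hC
  obtain ⟨a₂, h₂⟩ := hcross A hA D hD
  obtain ⟨b₁, h₃⟩ := hcross B hB C hC
  obtain ⟨b₂, h₄⟩ := hcross B hB D hD
  rw [mem_inter] at h₁ h₂ h₃ h₄
  rw [disjoint_left] at hAB hCD
  have ha₁₂ : a₁ ≠ a₂ := fun h ↦ hCD h₁.2 (h ▸ h₂.2)
  have hb₁₂ : b₁ ≠ b₂ := fun h ↦ hCD h₃.2 (h ▸ h₄.2)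
  have hab₁ : a₁ ≠ b₁ := fun h ↦ hAB h₁.1 (h ▸ h₃.1)
  have hab₂ : a₂ ≠ b₂ := fun h ↦ hAB h₂.1 (h ▸ h₄.1)
  obtain ⟨a₃, ha₃₁, ha₃₂, rfl⟩ := exists_eq_insert_insert_of_card_eq_three
    (mem_powersetCard.1 (hF hA)).2 h₁.1 h₂.1 ha₁₂
  obtain ⟨b₃, hb₃₁, hb₃₂, rfl⟩ := exists_eq_insert_insert_of_card_eq_three
    (mem_powersetCard.1 (hF hB)).2 h₃.1 h₄.1 hb₁₂
  obtain ⟨c, hc₁, hc₂, rfl⟩ := exists_eq_insert_insert_of_card_eq_three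
    (mem_powersetCard.1 (hG hC)).2 h₁.2 h₃.2 hab₁
  obtain ⟨d, hd₁, hd₂, rfl⟩ := exists_eq_insert_insert_of_card_eq_three
    (mem_powersetCard.1 (hG hD)).2 h₂.2 h₄.2 hab₂
  simp only [mem_insert, mem_singleton, not_or, forall_eq_or_imp, forall_eq] at hAB hCD
  have hA' : {a₂, a₁, a₃} ∈ F := insert_comm a₁ a₂ {a₃} ▸ hA
  have hB' : {b₂, b₁, b₃} ∈ F := insert_comm b₁ b₂ {b₃} ▸ hB
  have hC' : {b₁, a₁, c} ∈ G := insert_comm a₁ b₁ {c} ▸ hC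
  have hD' : {b₂, a₂, d} ∈ G := insert_comm a₂ b₂ {d} ▸ hD
  by_cases hca : c = a₃
  · subst hca
    by_cases hdb : d = b₃
    · subst hdb
      exact card_add_card_le_of_span_six hn hF hG hcross hF3 hG3 (by simp; grind only) hA hB hC hD
    · exact card_add_card_le_of_span_seven hn hF hG hcross hF3 hG3 (by simp; grind only) hA hB hC hD
  by_cases hcb : c = b₃
  · subst hcb
    by_cases hda : d = a₃
    · subst hda
      exact card_add_card_le_of_span_six hn hF hG hcross hF3 hG3 (by simp; grind only) hB hA hC' hD'
    · exact card_add_card_le_of_span_seven hn hF hG hcross hF3 hG3 (by simp; grind only)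
        hB hA hC' hD'
  by_cases hda : d = a₃
  · subst hda
    exact card_add_card_le_of_span_seven hn hF hG hcross hF3 hG3 (by simp; grind only) hA' hB' hD hC
  by_cases hdb : d = b₃
  · subst hdb
    exact card_add_card_le_of_span_seven hn hF hG hcross hF3 hG3 (by simp; grind only)
        hB' hA' hD' hC'
  exact card_add_card_le_of_span_eight hF hG hcross (by simp; grind only) hA hB hC hD

/-- If `ℱ, 𝒢 ⊆ ([n] choose 3)` are non-empty cross-intersecting families with
`|ℱ ∩ 𝒢| ≤ 2`, `|ℱ| ≥ 3` and `|𝒢| ≥ 3`, then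
`|ℱ| + |𝒢| ≤ C(n,3) − C(n−3,3) − C(n−4,2) − C(n−5,1) + 2`. -/
theorem stmt_17 (n : ℕ) (hn : 7 ≤ n)
    (F G : Finset (Finset ℕ))
    (hF : F ⊆ powersetCard 3 (Icc 1 n))
    (hG : G ⊆ powersetCard 3 (Icc 1 n))
    (hFne : F.Nonempty) (hGne : G.Nonempty)
    (hcross : ∀ A ∈ F, ∀ B ∈ G, (A ∩ B).Nonempty)
    (hmeet : (F ∩ G).card ≤ 2)
    (hF3 : 3 ≤ F.card) (hG3 : 3 ≤ G.card) :
    (F.card : ℤ) + G.card ≤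
      (n.choose 3 : ℤ) - (n - 3).choose 3 - (n - 4).choose 2 - (n - 5).choose 1 + 2 := by
  obtain ⟨k, rfl⟩ : ∃ k, n = k + 5 := ⟨n - 5, by lia⟩
  have hchoose := choose_three_eq k
  have hcard := card_union_add_card_inter F G
  rw [show k + 5 - 3 = k + 2 by lia, show k + 5 - 4 = k + 1 by lia, Nat.add_sub_cancel,
    Nat.choose_one_right]
  rw [Nat.choose_one_right] at hchoose
  by_cases hFint : ∀ A ∈ F, ∀ B ∈ F, (A ∩ B).Nonempty
  · have := card_union_add_le_of_intersecting hn hF hG hcross hF3 hFint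
    rw [show k + 5 - 3 = k + 2 by lia, show k + 5 - 4 = k + 1 by lia, Nat.add_sub_cancel] at this
    lia
  by_cases hGint : ∀ A ∈ G, ∀ B ∈ G, (A ∩ B).Nonempty
  · have := card_union_add_le_of_intersecting hn hG hF
      (fun A hA B hB ↦ inter_comm B A ▸ hcross B hB A hA) hG3 hGint
    rw [show k + 5 - 3 = k + 2 by lia, show k + 5 - 4 = k + 1 by lia, Nat.add_sub_cancel,
      union_comm] at this
    lia
  simp only [not_forall, ← not_disjoint_iff_nonempty_inter, not_not] at hFint hGint
  obtain ⟨A, hA, B, hB, hAB⟩ := hFint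
  obtain ⟨C, hC, D, hD, hCD⟩ := hGint
  have := card_add_card_le_of_disjoint hn hF hG hcross hF3 hG3 hA hB hC hD hAB hCD
  zify at this hchoose
  nlinarith
end

section
/- Let n ≥ 7 be an integer and let x₁ ≠ x₂ be two elements of [n]. Let ℱ and 𝒢 be cross-intersecting subfamilies of {A ∈ ([n] choose 3) : A ∩ {x₁,x₂} ≠ ∅}, and set ℛ = {A ∈ ([n] choose 3) : {x₁,x₂} ⊆ A}. Suppose that ℛ is a proper subfamily of ℱ, ℛ is a proper subfamily of 𝒢, and (ℱ ∖ ℛ) ∩ (𝒢 ∖ ℛ) = ∅. Then |ℱ| + |𝒢| ≤ C(n,3) − C(n−3,3) − C(n−4,2) − C(n−5,1) + 2. -/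
open Finset

/-- The edges on `V` containing `a` number at most `#V - 1`. -/
lemma card_star_le (V : Finset ℕ) {a : ℕ} (ha : a ∈ V) :
    #((V.erase a).image fun x => ({a, x} : Finset ℕ)) ≤ #V - 1 :=
  card_image_le.trans (card_erase_of_mem ha).le

lemma mem_star_of_mem {V p : Finset ℕ} {a : ℕ} (hp : p ∈ powersetCard 2 V) (ha : a ∈ p) :
    p ∈ (V.erase a).image fun x => ({a, x} : Finset ℕ) := by
  rw [mem_powersetCard] at hp
  obtain ⟨u, v, huv, rfl⟩ := card_eq_two.mp hp.2
  have hu : u ∈ V := hp.1 (by simp)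
  have hv : v ∈ V := hp.1 (by simp)
  rw [mem_image]
  rw [mem_insert, mem_singleton] at ha
  rcases ha with rfl | rfl
  · exact ⟨v, by simp [hv, huv.symm], rfl⟩
  · exact ⟨u, by simp [hu, huv], pair_comm _ _⟩

lemma eq_pair_of_mem {p : Finset ℕ} {a b : ℕ} (hp : #p = 2) (hab : a ≠ b) (ha : a ∈ p)
    (hb : b ∈ p) : p = {a, b} :=
  (eq_of_subset_of_card_le (by simp [insert_subset_iff, ha, hb])
    (by rw [hp, card_pair hab])).symm

lemma pair_inter_nonempty_s19 {p : Finset ℕ} {a b : ℕ} :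
    (p ∩ {a, b}).Nonempty ↔ a ∈ p ∨ b ∈ p := by
  constructor
  · rintro ⟨x, hx⟩
    simp only [mem_inter, mem_insert, mem_singleton] at hx
    rcases hx with ⟨h, rfl | rfl⟩ <;> simp [h]
  · rintro (h | h)
    · exact ⟨a, by simp [h]⟩
    · exact ⟨b, by simp [h]⟩

section EdgeFamilies

variable {V : Finset ℕ} {P Q : Finset (Finset ℕ)}

lemma card_le_of_cross_one (hP : P ⊆ powersetCard 2 V) (hQ : Q ⊆ powersetCard 2 V)
    (h : ∀ p ∈ P, ∀ q ∈ Q, (p ∩ q).Nonempty) (hne : Q.Nonempty) :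
    #P ≤ 2 * #V - 3 := by
  obtain ⟨q, hq⟩ := hne
  have hq2 := mem_powersetCard.mp (hQ hq)
  obtain ⟨a, b, hab, rfl⟩ := card_eq_two.mp hq2.2
  have ha : a ∈ V := hq2.1 (by simp)
  have hb : b ∈ V := hq2.1 (by simp)
  have hsub : P ⊆ (V.erase a).image (fun x => ({a, x} : Finset ℕ)) ∪
      ((V.erase a).erase b).image (fun x => ({b, x} : Finset ℕ)) := by
    intro p hp
    rw [mem_union]
    by_cases hap : a ∈ p
    · exact Or.inl (mem_star_of_mem (hP hp) hap)
    · refine Or.inr (mem_star_of_mem ?_ ((pair_inter_nonempty_s19.mp (h p hp _ hq)).resolve_left hap))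
      have hpV := mem_powersetCard.mp (hP hp)
      exact mem_powersetCard.mpr ⟨fun x hx => mem_erase.mpr
        ⟨fun e => hap (e ▸ hx), hpV.1 hx⟩, hpV.2⟩
  have h1 := card_star_le V ha
  have h2 := card_star_le (V.erase a) (mem_erase.mpr ⟨hab.symm, hb⟩)
  rw [card_erase_of_mem ha] at h2
  have := (card_le_card hsub).trans (card_union_le _ _)
  have : 2 ≤ #V := hq2.2 ▸ card_le_card hq2.1
  omega

lemma card_le_four_of_disjoint (hP : P ⊆ powersetCard 2 V)
    {q r : Finset ℕ} (hq : q ∈ powersetCard 2 V) (hr : r ∈ powersetCard 2 V) (hqr : Disjoint q r)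
    (h : ∀ p ∈ P, (p ∩ q).Nonempty ∧ (p ∩ r).Nonempty) : #P ≤ 4 := by
  have hq2 := (mem_powersetCard.mp hq).2
  have hr2 := (mem_powersetCard.mp hr).2
  have hsub : P ⊆ (q ×ˢ r).image fun x => ({x.1, x.2} : Finset ℕ) := by
    intro p hp
    obtain ⟨⟨x, hx⟩, ⟨y, hy⟩⟩ := h p hp
    rw [mem_inter] at hx hy
    exact mem_image.mpr ⟨(x, y), mk_mem_product hx.2 hy.2,
      (eq_pair_of_mem (mem_powersetCard.mp (hP hp)).2 (disjoint_iff_ne.mp hqr x hx.2 y hy.2)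
        hx.1 hy.1).symm⟩
  have := (card_le_card hsub).trans card_image_le
  rwa [card_product, hq2, hr2] at this

/-- Two distinct meeting edges share one endpoint. -/
lemma exists_common_endpoint {q r : Finset ℕ} (hq : #q = 2) (hr : #r = 2) (hne : q ≠ r)
    (hqr : ¬ Disjoint q r) :
    ∃ a b c, a ≠ b ∧ a ≠ c ∧ b ≠ c ∧ q = {a, b} ∧ r = {a, c} := by
  obtain ⟨a, haq, har⟩ := not_disjoint_iff.mp hqr
  have hq' : #(q.erase a) = 1 := by rw [card_erase_of_mem haq, hq]
  have hr' : #(r.erase a) = 1 := by rw [card_erase_of_mem har, hr]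
  obtain ⟨b, hb⟩ := card_eq_one.mp hq'
  obtain ⟨c, hc⟩ := card_eq_one.mp hr'
  have hb' : b ∈ q.erase a := by simp [hb]
  have hc' : c ∈ r.erase a := by simp [hc]
  rw [mem_erase] at hb' hc'
  have h1 := eq_pair_of_mem hq hb'.1.symm haq hb'.2
  have h2 := eq_pair_of_mem hr hc'.1.symm har hc'.2
  refine ⟨a, b, c, hb'.1.symm, hc'.1.symm, ?_, h1, h2⟩
  rintro rfl
  exact hne (h1.trans h2.symm)

lemma subset_star_or_eq (hP : P ⊆ powersetCard 2 V) {a b c : ℕ} (hbc : b ≠ c)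
    (h : ∀ p ∈ P, (p ∩ {a, b}).Nonempty ∧ (p ∩ {a, c}).Nonempty) :
    P ⊆ insert {b, c} ((V.erase a).image fun x => ({a, x} : Finset ℕ)) := by
  intro p hp
  obtain ⟨h1, h2⟩ := h p hp
  rw [pair_inter_nonempty_s19] at h1 h2
  rw [mem_insert]
  by_cases ha : a ∈ p
  · exact Or.inr (mem_star_of_mem (hP hp) ha)
  · exact Or.inl (eq_pair_of_mem (mem_powersetCard.mp (hP hp)).2 hbc
      (h1.resolve_left ha) (h2.resolve_left ha))

lemma card_le_of_cross_two (hV : 5 ≤ #V) (hP : P ⊆ powersetCard 2 V)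
    (hQ : Q ⊆ powersetCard 2 V) (h : ∀ p ∈ P, ∀ q ∈ Q, (p ∩ q).Nonempty) (h2 : 2 ≤ #Q) :
    #P ≤ #V := by
  obtain ⟨q, hq, r, hr, hqr⟩ := one_lt_card.mp h2
  by_cases hd : Disjoint q r
  · have := card_le_four_of_disjoint hP (hQ hq) (hQ hr) hd fun p hp => ⟨h p hp q hq, h p hp r hr⟩
    omega
  have hqV := mem_powersetCard.mp (hQ hq)
  obtain ⟨a, b, c, -, -, hbc, rfl, rfl⟩ :=
    exists_common_endpoint hqV.2 (mem_powersetCard.mp (hQ hr)).2 hqr hd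
  have hsub := subset_star_or_eq hP hbc fun p hp => ⟨h p hp _ hq, h p hp _ hr⟩
  have h1 := card_star_le V (hqV.1 (mem_insert_self a _))
  have := (card_le_card hsub).trans (card_insert_le _ _)
  omega

lemma card_le_of_cross_three (hV : 5 ≤ #V) (hP : P ⊆ powersetCard 2 V)
    (hQ : Q ⊆ powersetCard 2 V) (h : ∀ p ∈ P, ∀ q ∈ Q, (p ∩ q).Nonempty) (h3 : 3 ≤ #Q) :
    #P ≤ #V - 1 := by
  by_cases hd : ∃ q ∈ Q, ∃ r ∈ Q, Disjoint q r
  · obtain ⟨q, hq, r, hr, hd⟩ := hd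
    have := card_le_four_of_disjoint hP (hQ hq) (hQ hr) hd fun p hp => ⟨h p hp q hq, h p hp r hr⟩
    omega
  push Not at hd
  obtain ⟨q, hq, r, hr, s, hs, hqr, hqs, hrs⟩ := two_lt_card.mp h3
  have hqV := mem_powersetCard.mp (hQ hq)
  have hsV := mem_powersetCard.mp (hQ hs)
  have hds := hd _ hq _ hs
  have hdr := hd _ hr _ hs
  obtain ⟨a, b, c, hab, hac, hbc, rfl, rfl⟩ :=
    exists_common_endpoint hqV.2 (mem_powersetCard.mp (hQ hr)).2 hqr (hd _ hq _ hr)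
  have ha : a ∈ V := hqV.1 (mem_insert_self a _)
  have hsub := subset_star_or_eq hP hbc fun p hp => ⟨h p hp _ hq, h p hp _ hr⟩
  by_cases has : a ∈ s
  · refine (card_le_card fun p hp => ?_).trans (card_star_le V ha)
    refine (mem_insert.mp (hsub hp)).resolve_left ?_
    rintro rfl
    have hbcs := h _ hp _ hs
    rw [inter_comm, pair_inter_nonempty_s19] at hbcs
    rcases hbcs with hb | hc
    · exact hqs (eq_pair_of_mem hsV.2 hab has hb).symm
    · exact hrs (eq_pair_of_mem hsV.2 hac has hc).symm
  · rw [not_disjoint_iff_nonempty_inter, inter_comm, pair_inter_nonempty_s19] at hds hdr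
    obtain rfl := eq_pair_of_mem hsV.2 hbc (hds.resolve_left has) (hdr.resolve_left has)
    have hsub' : P ⊆ {{b, c}, {a, b}, {a, c}} := by
      intro p hp
      have hp2 := (mem_powersetCard.mp (hP hp)).2
      have h1 := pair_inter_nonempty_s19.mp (h p hp _ hq)
      have h2 := pair_inter_nonempty_s19.mp (h p hp _ hr)
      have h3 := pair_inter_nonempty_s19.mp (h p hp _ hs)
      simp only [mem_insert, mem_singleton]
      by_cases hap : a ∈ p
      · rcases h3 with hb | hc
        · exact Or.inr (Or.inl (eq_pair_of_mem hp2 hab hap hb))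
        · exact Or.inr (Or.inr (eq_pair_of_mem hp2 hac hap hc))
      · exact Or.inl (eq_pair_of_mem hp2 hbc (h1.resolve_left hap) (h2.resolve_left hap))
    have := (card_le_card hsub').trans card_le_three
    omega

/-- Nonempty cross-intersecting families of edges on at least five vertices. -/
lemma card_add_card_le_of_cross (hV : 5 ≤ #V) (hP : P ⊆ powersetCard 2 V)
    (hQ : Q ⊆ powersetCard 2 V) (h : ∀ p ∈ P, ∀ q ∈ Q, (p ∩ q).Nonempty)
    (hPne : P.Nonempty) (hQne : Q.Nonempty) : #P + #Q ≤ 2 * #V - 2 := by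
  have h' : ∀ q ∈ Q, ∀ p ∈ P, (q ∩ p).Nonempty := fun q hq p hp => by
    rw [inter_comm]; exact h p hp q hq
  have a1 := card_le_of_cross_one hP hQ h hQne
  have b1 := card_le_of_cross_one hQ hP h' hPne
  have a2 := card_le_of_cross_two hV hP hQ h
  have b2 := card_le_of_cross_two hV hQ hP h'
  have a3 := card_le_of_cross_three hV hP hQ h
  have b3 := card_le_of_cross_three hV hQ hP h'
  have := hPne.card_pos
  have := hQne.card_pos
  by_cases 3 ≤ #P <;> by_cases 3 ≤ #Q <;> by_cases 2 ≤ #P <;> by_cases 2 ≤ #Q <;> omega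

end EdgeFamilies

lemma three_mul_le_choose_two (k : ℕ) : 3 * (k + 5) ≤ (k + 5).choose 2 + 5 := by
  have h1 := Nat.choose_succ_succ (k + 4) 1
  have h2 := Nat.choose_succ_succ (k + 3) 1
  have h3 := Nat.choose_succ_succ (k + 2) 1
  have h4 : 0 < (k + 2).choose 2 := Nat.choose_pos (by omega)
  simp only [Nat.choose_one_right, Nat.succ_eq_add_one, Nat.reduceAdd, add_assoc] at *
  omega

/-- Two pairs of disjoint edge families, crosswise cross-intersecting. -/
lemma card_four_le_of_cross {V : Finset ℕ} (hV : 5 ≤ #V) {F₁ F₂ G₁ G₂ : Finset (Finset ℕ)}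
    (hF₁ : F₁ ⊆ powersetCard 2 V) (hF₂ : F₂ ⊆ powersetCard 2 V)
    (hG₁ : G₁ ⊆ powersetCard 2 V) (hG₂ : G₂ ⊆ powersetCard 2 V)
    (h₁ : ∀ p ∈ F₁, ∀ q ∈ G₂, (p ∩ q).Nonempty) (h₂ : ∀ p ∈ F₂, ∀ q ∈ G₁, (p ∩ q).Nonempty)
    (hd₁ : Disjoint F₁ G₁) (hd₂ : Disjoint F₂ G₂)
    (hF : F₁.Nonempty ∨ F₂.Nonempty) (hG : G₁.Nonempty ∨ G₂.Nonempty) :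
    #F₁ + #F₂ + #G₁ + #G₂ + #V ≤ 2 * (#V).choose 2 + 3 := by
  have c1 := card_le_card (union_subset hF₁ hG₁)
  have c2 := card_le_card (union_subset hF₂ hG₂)
  rw [card_union_of_disjoint hd₁, card_powersetCard] at c1
  rw [card_union_of_disjoint hd₂, card_powersetCard] at c2
  have e1 := card_add_card_le_of_cross hV hF₁ hG₂ h₁
  have e2 := card_add_card_le_of_cross hV hF₂ hG₁ h₂
  have hc : 3 * #V ≤ (#V).choose 2 + 5 := by
    obtain ⟨k, hk⟩ := Nat.exists_eq_add_of_le' hV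
    rw [hk]
    exact three_mul_le_choose_two k
  simp only [← card_pos] at *
  omega

/-- The link of `x` in `F`, restricted to edges on `V`. -/
def edgeLink (V : Finset ℕ) (F : Finset (Finset ℕ)) (x : ℕ) : Finset (Finset ℕ) :=
  (powersetCard 2 V).filter fun e => insert x e ∈ F

lemma edgeLink_subset (V : Finset ℕ) (F : Finset (Finset ℕ)) (x : ℕ) :
    edgeLink V F x ⊆ powersetCard 2 V :=
  filter_subset _ _

lemma erase_mem_edgeLink {S A : Finset ℕ} {F : Finset (Finset ℕ)} {x y : ℕ} (hA : A ∈ F)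
    (hAS : A ∈ powersetCard 3 S) (hx : x ∈ A) (hy : y ∉ A) :
    A.erase x ∈ edgeLink (S \ {x, y}) F x := by
  rw [mem_powersetCard] at hAS
  rw [edgeLink, mem_filter, mem_powersetCard, insert_erase hx, card_erase_of_mem hx, hAS.2]
  refine ⟨⟨fun z hz => ?_, rfl⟩, hA⟩
  rw [mem_erase] at hz
  simp only [mem_sdiff, mem_insert, mem_singleton, not_or]
  exact ⟨hAS.1 hz.2, hz.1, fun e => hy (e ▸ hz.2)⟩

lemma card_le_card_edgeLink {S : Finset ℕ} {F : Finset (Finset ℕ)} {x y : ℕ} (hxy : x ≠ y)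
    (hF : F ⊆ (powersetCard 3 S).filter fun A => (A ∩ {x, y}).Nonempty) :
    #F ≤ #(S \ {x, y}) + #(edgeLink (S \ {x, y}) F x) + #(edgeLink (S \ {x, y}) F y) := by
  have hsub : F ⊆ (S \ {x, y}).image (fun z => {x, y, z}) ∪
      (edgeLink (S \ {x, y}) F x).image (insert x) ∪
      (edgeLink (S \ {x, y}) F y).image (insert y) := by
    intro A hA
    obtain ⟨hAS, hAxy⟩ := mem_filter.mp (hF hA)
    rw [pair_inter_nonempty_s19] at hAxy
    simp only [mem_union, mem_image]
    by_cases hx : x ∈ A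
    · by_cases hy : y ∈ A
      · left; left
        have hs : {x, y} ⊆ A := by simp [insert_subset_iff, hx, hy]
        rw [mem_powersetCard] at hAS
        have hc : #(A \ {x, y}) = 1 := by
          rw [card_sdiff_of_subset hs, card_pair hxy, hAS.2]
        obtain ⟨z, hz⟩ := card_eq_one.mp hc
        refine ⟨z, sdiff_subset_sdiff hAS.1 le_rfl (hz ▸ mem_singleton_self z), ?_⟩
        rw [← union_sdiff_of_subset hs, hz, insert_union, singleton_union]
      · exact Or.inl (Or.inr ⟨_, erase_mem_edgeLink hA hAS hx hy, insert_erase hx⟩)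
    · have hy := hAxy.resolve_left hx
      refine Or.inr ⟨_, ?_, insert_erase hy⟩
      rw [pair_comm]
      exact erase_mem_edgeLink hA hAS hy hx
  refine (card_le_card hsub).trans ((card_union_le _ _).trans ?_)
  exact add_le_add ((card_union_le _ _).trans (add_le_add card_image_le card_image_le))
    card_image_le

lemma edgeLink_nonempty {S : Finset ℕ} {F : Finset (Finset ℕ)} {x y : ℕ}
    (hF : F ⊆ (powersetCard 3 S).filter fun A => (A ∩ {x, y}).Nonempty)
    (hR : (powersetCard 3 S).filter (fun A => {x, y} ⊆ A) ⊂ F) :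
    (edgeLink (S \ {x, y}) F x).Nonempty ∨ (edgeLink (S \ {x, y}) F y).Nonempty := by
  obtain ⟨A, hA, hAR⟩ := exists_of_ssubset hR
  obtain ⟨hAS, hAxy⟩ := mem_filter.mp (hF hA)
  rw [pair_inter_nonempty_s19] at hAxy
  simp only [mem_filter, hAS, true_and, insert_subset_iff, singleton_subset_iff] at hAR
  by_cases hx : x ∈ A
  · exact Or.inl ⟨_, erase_mem_edgeLink hA hAS hx fun hy => hAR ⟨hx, hy⟩⟩
  · refine Or.inr ⟨A.erase y, ?_⟩
    rw [pair_comm]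
    exact erase_mem_edgeLink hA hAS (hAxy.resolve_left hx) hx

lemma edgeLink_cross {V : Finset ℕ} {F G : Finset (Finset ℕ)} {x y : ℕ} (hxy : x ≠ y)
    (hx : x ∉ V) (hy : y ∉ V) (h : ∀ A ∈ F, ∀ B ∈ G, (A ∩ B).Nonempty) :
    ∀ p ∈ edgeLink V F x, ∀ q ∈ edgeLink V G y, (p ∩ q).Nonempty := by
  intro p hp q hq
  rw [edgeLink, mem_filter, mem_powersetCard] at hp hq
  obtain ⟨z, hz⟩ := h _ hp.2 _ hq.2
  simp only [mem_inter, mem_insert] at hz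
  obtain ⟨rfl | hzp, rfl | hzq⟩ := hz
  · exact absurd rfl hxy
  · exact absurd (hq.1.1 hzq) hx
  · exact absurd (hp.1.1 hzp) hy
  · exact ⟨z, mem_inter.mpr ⟨hzp, hzq⟩⟩

lemma edgeLink_disjoint {V : Finset ℕ} {F G R : Finset (Finset ℕ)} {x : ℕ}
    (hR : ∀ e ∈ powersetCard 2 V, insert x e ∉ R) (h : (F \ R) ∩ (G \ R) = ∅) :
    Disjoint (edgeLink V F x) (edgeLink V G x) := by
  rw [disjoint_left]
  intro e he he'
  rw [edgeLink, mem_filter] at he he'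
  have : insert x e ∈ (F \ R) ∩ (G \ R) := by
    simp [he.2, he'.2, hR e he.1]
  simp [h] at this

theorem stmt_19 (n : ℕ) (hn : 7 ≤ n) (x₁ x₂ : ℕ)
    (hx₁ : x₁ ∈ Icc 1 n) (hx₂ : x₂ ∈ Icc 1 n) (hx : x₁ ≠ x₂)
    (F G : Finset (Finset ℕ))
    (hF : F ⊆ (powersetCard 3 (Icc 1 n)).filter fun A => (A ∩ {x₁, x₂}).Nonempty)
    (hG : G ⊆ (powersetCard 3 (Icc 1 n)).filter fun A => (A ∩ {x₁, x₂}).Nonempty)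
    (hcross : ∀ A ∈ F, ∀ B ∈ G, (A ∩ B).Nonempty)
    (hRF : (powersetCard 3 (Icc 1 n)).filter (fun A => {x₁, x₂} ⊆ A) ⊂ F)
    (hRG : (powersetCard 3 (Icc 1 n)).filter (fun A => {x₁, x₂} ⊆ A) ⊂ G)
    (hdisj : (F \ (powersetCard 3 (Icc 1 n)).filter (fun A => {x₁, x₂} ⊆ A))
        ∩ (G \ (powersetCard 3 (Icc 1 n)).filter (fun A => {x₁, x₂} ⊆ A)) = ∅) :
    (F.card : ℤ) + G.card ≤
      (n.choose 3 : ℤ) - (n - 3).choose 3 - (n - 4).choose 2 - (n - 5).choose 1 + 2 := by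
  have f0 := card_le_card_edgeLink hx hF
  have g0 := card_le_card_edgeLink hx hG
  have fne := edgeLink_nonempty hF hRF
  have gne := edgeLink_nonempty hG hRG
  have hVcard : #(Icc 1 n \ {x₁, x₂}) = n - 2 := by
    rw [card_sdiff_of_subset (by simp only [insert_subset_iff, singleton_subset_iff, hx₁, hx₂,
      and_self]), card_pair hx, Nat.card_Icc]
    omega
  have hx₁V : x₁ ∉ Icc 1 n \ {x₁, x₂} := by simp
  have hx₂V : x₂ ∉ Icc 1 n \ {x₁, x₂} := by simp
  generalize Icc 1 n \ {x₁, x₂} = V at *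
  have d₁ : Disjoint (edgeLink V F x₁) (edgeLink V G x₁) := by
    refine edgeLink_disjoint (fun e he hR => ?_) hdisj
    have h2 : x₂ ∈ insert x₁ e := (mem_filter.mp hR).2 (by simp)
    exact hx₂V ((mem_powersetCard.mp he).1 (mem_of_mem_insert_of_ne h2 hx.symm))
  have d₂ : Disjoint (edgeLink V F x₂) (edgeLink V G x₂) := by
    refine edgeLink_disjoint (fun e he hR => ?_) hdisj
    have h1 : x₁ ∈ insert x₂ e := (mem_filter.mp hR).2 (by simp)
    exact hx₁V ((mem_powersetCard.mp he).1 (mem_of_mem_insert_of_ne h1 hx))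
  have key := card_four_le_of_cross (by omega) (edgeLink_subset V F x₁)
    (edgeLink_subset V F x₂) (edgeLink_subset V G x₁) (edgeLink_subset V G x₂) (edgeLink_cross hx hx₁V hx₂V hcross)
    (edgeLink_cross hx.symm hx₂V hx₁V hcross) d₁ d₂ fne gne
  obtain ⟨k, rfl⟩ := Nat.exists_eq_add_of_le' hn
  have a1 := Nat.choose_succ_succ (k + 6) 2
  have a2 := Nat.choose_succ_succ (k + 5) 2
  have a3 := Nat.choose_succ_succ (k + 4) 2
  have b1 := Nat.choose_succ_succ (k + 5) 1
  have b2 := Nat.choose_succ_succ (k + 4) 1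
  have b3 := Nat.choose_succ_succ (k + 3) 1
  simp only [hVcard, Nat.choose_one_right, Nat.succ_eq_add_one, Nat.reduceAdd, add_assoc,
    show k + 7 - 2 = k + 5 from rfl, show k + 7 - 3 = k + 4 from rfl,
    show k + 7 - 4 = k + 3 from rfl, show k + 7 - 5 = k + 2 from rfl] at *
  omega
end
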